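/- (Smooth linearization for systems of type (n,0), general corank.) Let X_1, ..., X_n be pairwise commuting smooth vector fields on an open neighborhood U of a point p in ℝ^n, with m := n − dim span{X_1(p), ..., X_n(p)} > 0. Assume (after renumbering) that X_{m+1}(p), ..., X_n(p) are linearly independent, that there exist constants c_{ik} such that Z_i := X_i − Σ_{k=1}^{n−m} c_{ik} X_{m+k} satisfies Z_i(p) = 0 for i = 1, ..., m, and that the nondegeneracy condition holds: the endomorphisms induced by DZ_1(p), ..., DZ_m(p) on the quotient ℝ^n / span{X_{m+1}(p), ..., X_n(p)} are semisimple and the associated linear vector fields on this m-dimensional quotient are linearly independent on a dense subset. Then there exist nonnegative integers h, e with h + 2e = m, a smooth local coordinate system (x_1, ..., x_n) centered at p (i.e. a smooth diffeomorphism from a neighborhood of p onto a neighborhood of 0 in ℝ^n sending p to 0), and a basis (v_1, ..., v_n) of ℝ^n, such that the vector fields Y_i := Σ_j v_i^j X_j expressed in these coordinates are: Y_i = x_i ∂/∂x_i for i = 1, ..., h; Y_{h+2j−1} = x_{h+2j−1} ∂/∂x_{h+2j−1} + x_{h+2j} ∂/∂x_{h+2j} and Y_{h+2j} = x_{h+2j−1}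 ∂/∂x_{h+2j} − x_{h+2j} ∂/∂x_{h+2j−1} for j = 1, ..., e; and Y_k = ∂/∂x_k for k = m+1, ..., n. -/

import Mathlib

open scoped BigOperators

/-- The model vector fields on ℝⁿ of the normal form with `h` hyperbolic components,
elbolic pairs filling indices `h, ..., m-1`, and constant (regular) vector fields
`∂/∂x_k` for `k ≥ m` (0-indexed). -/
noncomputable def modelVF (n m h : ℕ) (i : Fin n) (y : Fin n → ℝ) : Fin n → ℝ :=
  if (i : ℕ) < h then Pi.single i (y i)
  else if him : (i : ℕ) < m then
    (if ((i : ℕ) - h) % 2 = 0 then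
      (if hlt : (i : ℕ) + 1 < n then
        Pi.single i (y i) + Pi.single (⟨(i : ℕ) + 1, hlt⟩ : Fin n) (y ⟨(i : ℕ) + 1, hlt⟩)
       else 0)
     else
      (if hpos : 0 < (i : ℕ) then
        Pi.single i (y ⟨(i : ℕ) - 1, by omega⟩) -
          Pi.single (⟨(i : ℕ) - 1, by omega⟩ : Fin n) (y i)
       else 0))
  else Pi.single i 1

section helpers

open Set Filter Topology

/-- Pointwise application of an operator valued curve to a curve, as a continuous linear map. -/
noncomputable def pwApply (K V F : Type) [TopologicalSpace K] [CompactSpace K]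
    [NormedAddCommGroup V] [NormedSpace ℝ V] [NormedAddCommGroup F] [NormedSpace ℝ F] :
    C(K, V →L[ℝ] F) →L[ℝ] C(K, V) →L[ℝ] C(K, F) :=
  LinearMap.mkContinuous₂
    (LinearMap.mk₂ ℝ (fun (a : C(K, V →L[ℝ] F)) (g : C(K, V)) =>
        (⟨fun s => a s (g s), by fun_prop⟩ : C(K, F)))
      (by intros; ext; simp) (by intros; ext; simp) (by intros; ext; simp) (by intros; ext; simp))
    1 (by
      intro a g
      rw [ContinuousMap.norm_le _ (by positivity)]
      intro s
      calc ‖a s (g s)‖ ≤ ‖a s‖ * ‖g s‖ := (a s).le_opNorm _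
        _ ≤ 1 * ‖a‖ * ‖g‖ := by
          rw [one_mul]
          gcongr
          · exact a.norm_coe_le_norm s
          · exact g.norm_coe_le_norm s)

lemma pwApply_apply {K V F : Type} [TopologicalSpace K] [CompactSpace K]
    [NormedAddCommGroup V] [NormedSpace ℝ V] [NormedAddCommGroup F] [NormedSpace ℝ F]
    (a : C(K, V →L[ℝ] F)) (g : C(K, V)) (s : K) : pwApply K V F a g s = a s (g s) := rfl

/-- Nemytskii operator. -/
def nem {K V F : Type} [TopologicalSpace K] [TopologicalSpace V] [TopologicalSpace F]
    (f : C(V, F)) (g : C(K, V)) : C(K, F) := f.comp g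

lemma nem_hasFDerivAt {K V F : Type} [TopologicalSpace K] [CompactSpace K]
    [NormedAddCommGroup V] [NormedSpace ℝ V] [NormedAddCommGroup F] [NormedSpace ℝ F]
    (f : C(V, F)) (f' : C(V, V →L[ℝ] F)) (hf : ∀ x, HasFDerivAt f (f' x) x) (g : C(K, V)) :
    HasFDerivAt (fun g : C(K, V) => nem f g) (pwApply K V F (nem f' g)) g := by
  rw [hasFDerivAt_iff_isLittleO_nhds_zero, Asymptotics.isLittleO_iff]
  intro ε hε
  have hc : Continuous (fun g : C(K, V) => nem f' g) := f'.continuous_postcomp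
  obtain ⟨δ, hδ, H⟩ :=
    (Metric.continuous_iff (α := C(K, V)) (β := C(K, V →L[ℝ] F))).1 hc g ε hε
  filter_upwards [Metric.ball_mem_nhds (0 : C(K, V)) hδ] with h hh
  rw [mem_ball_zero_iff] at hh
  rw [ContinuousMap.norm_le _ (by positivity)]
  intro s
  have hhs : ‖h s‖ ≤ ‖h‖ := h.norm_coe_le_norm s
  have key : ∀ z ∈ Metric.ball (g s) δ, ‖f' z - f' (g s)‖ ≤ ε := by
    intro z hz
    have h1 := H (g + ContinuousMap.const K (z - g s)) (by
      rw [dist_eq_norm, add_sub_cancel_left]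
      refine lt_of_le_of_lt ((ContinuousMap.norm_le _ (norm_nonneg (z - g s))).2 ?_) (mem_ball_iff_norm.1 hz)
      intro x; simp)
    have h2 := (ContinuousMap.dist_apply_le_dist s).trans h1.le
    rw [← dist_eq_norm]
    simpa [nem] using h2
  have h3 := (convex_ball (g s) δ).norm_image_sub_le_of_norm_hasFDerivWithin_le'
    (f := f) (f' := f') (φ := f' (g s)) (C := ε) (x := g s) (y := g s + h s)
    (fun x _ => (hf x).hasFDerivWithinAt) key (Metric.mem_ball_self hδ)
    (by rw [mem_ball_iff_norm]; simpa using lt_of_le_of_lt hhs hh)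
  simp only [add_sub_cancel_left] at h3
  refine le_trans ?_ (h3.trans (by gcongr))
  apply le_of_eq
  rfl

lemma nem_contDiff_nat {K V : Type} [TopologicalSpace K] [CompactSpace K]
    [NormedAddCommGroup V] [NormedSpace ℝ V] (n : ℕ) :
    ∀ {F : Type} [NormedAddCommGroup F] [NormedSpace ℝ F]
    (f : C(V, F)) (_ : ContDiff ℝ (⊤ : ℕ∞) f),
    ContDiff ℝ n (fun g : C(K, V) => nem f g) := by
  induction n with
  | zero =>
    intro F _ _ f hf
    exact contDiff_zero.2 f.continuous_postcomp
  | succ n ih =>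
    intro F _ _ f hf
    have hd : Differentiable ℝ f := hf.differentiable (by simp)
    have hf' : ContDiff ℝ (⊤ : ℕ∞) (fderiv ℝ f) := hf.fderiv_right (by simp)
    let f' : C(V, V →L[ℝ] F) := ⟨fderiv ℝ f, hf'.continuous⟩
    have hD := fun g : C(K, V) => nem_hasFDerivAt f f' (fun x => (hd x).hasFDerivAt) g
    rw [show ((n + 1 : ℕ) : WithTop ℕ∞) = (n : WithTop ℕ∞) + 1 by simp]
    rw [contDiff_succ_iff_fderiv]
    refine ⟨fun g => (hD g).differentiableAt, by simp, ?_⟩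
    have : fderiv ℝ (fun g : C(K, V) => nem f g) = fun g => pwApply K V F (nem f' g) :=
      funext fun g => (hD g).fderiv
    rw [this]
    exact (pwApply K V F).contDiff.comp (ih f' hf')

lemma nem_contDiff {K V F : Type} [TopologicalSpace K] [CompactSpace K]
    [NormedAddCommGroup V] [NormedSpace ℝ V] [NormedAddCommGroup F] [NormedSpace ℝ F]
    (f : C(V, F)) (hf : ContDiff ℝ (⊤ : ℕ∞) f) :
    ContDiff ℝ (⊤ : ℕ∞) (fun g : C(K, V) => nem f g) :=
  contDiff_infty.2 fun n => nem_contDiff_nat n f hf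

section curves
set_option linter.unusedSectionVars false
variable {V F : Type} [NormedAddCommGroup V] [NormedSpace ℝ V]
  [NormedAddCommGroup F] [NormedSpace ℝ F]

/-- Extension of a curve on `[0,1]` to the real line. -/
noncomputable def extC (k : C(unitInterval, V)) (σ : ℝ) : V := k (projIcc 0 1 zero_le_one σ)

lemma extC_continuous (k : C(unitInterval, V)) : Continuous (extC k) :=
  k.continuous.comp continuous_projIcc

lemma extC_of_mem (k : C(unitInterval, V)) (s : unitInterval) : extC k s = k s := by
  simp [extC]

lemma extC_norm (k : C(unitInterval, V)) (σ : ℝ) : ‖extC k σ‖ ≤ ‖k‖ := k.norm_coe_le_norm _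

/-- The weighted integration operator `k ↦ (s ↦ s ∫₀¹ θ^i k(sθ) dθ)`. -/
noncomputable def intL (i : ℕ) (V : Type) [NormedAddCommGroup V] [NormedSpace ℝ V] :
    C(unitInterval, V) →L[ℝ] C(unitInterval, V) :=
  LinearMap.mkContinuous
    { toFun := fun k => ⟨fun s => (s : ℝ) • ∫ θ in (0 : ℝ)..1, θ ^ i • extC k (s * θ), by
        have h : Continuous (fun s : ℝ => ∫ θ in (0 : ℝ)..1, θ ^ i • extC k (s * θ)) := by
          apply intervalIntegral.continuous_parametric_intervalIntegral_of_continuous'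
          have := extC_continuous k
          fun_prop
        exact continuous_subtype_val.smul (h.comp continuous_subtype_val)⟩
      map_add' := by
        intro a b
        ext s
        have ha := extC_continuous a
        have hb := extC_continuous b
        simp only [ContinuousMap.coe_mk, ContinuousMap.add_apply]
        rw [← smul_add, ← intervalIntegral.integral_add]
        · simp [extC]
        · exact Continuous.intervalIntegrable (by fun_prop) _ _
        · exact Continuous.intervalIntegrable (by fun_prop) _ _
      map_smul' := by
        intro c a
        ext s
        simp only [ContinuousMap.coe_mk, ContinuousMap.smul_apply, RingHom.id_apply]
        rw [smul_comm c]
        congr 1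
        rw [← intervalIntegral.integral_smul]
        apply intervalIntegral.integral_congr
        intro θ _
        exact smul_comm (θ ^ i) c (extC a (s * θ)) }
    1 (by
      intro k
      rw [ContinuousMap.norm_le _ (by positivity)]
      intro s
      have h1 : ‖∫ θ in (0 : ℝ)..1, θ ^ i • extC k (s * θ)‖ ≤ ‖k‖ * |1 - 0| := by
        apply intervalIntegral.norm_integral_le_of_norm_le_const
        intro x hx
        rw [uIoc_of_le zero_le_one] at hx
        rw [norm_smul]
        calc _ ≤ 1 * ‖k‖ := by
              gcongr
              · rw [norm_pow, Real.norm_eq_abs, abs_of_pos hx.1]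
                exact pow_le_one₀ hx.1.le hx.2
              · exact extC_norm k _
          _ = _ := one_mul _
      simp only [LinearMap.coe_mk, AddHom.coe_mk, ContinuousMap.coe_mk]
      rw [norm_smul, Real.norm_eq_abs, abs_of_nonneg s.2.1]
      gcongr
      · exact s.2.2
      · simpa using h1)

lemma intL_apply (i : ℕ) (k : C(unitInterval, V)) (s : unitInterval) :
    intL i V k s = (s : ℝ) • ∫ θ in (0 : ℝ)..1, θ ^ i • extC k (s * θ) := rfl

lemma pow_smul_intL (i : ℕ) (k : C(unitInterval, V)) (s : unitInterval) :
    (s : ℝ) ^ i • intL i V k s = ∫ σ in (0 : ℝ)..s, σ ^ i • extC k σ := by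
  have h := intervalIntegral.smul_integral_comp_mul_left (a := (0 : ℝ)) (b := 1)
    (fun σ : ℝ => σ ^ i • extC k σ) (s : ℝ)
  rw [mul_zero, mul_one] at h
  rw [← h, intL_apply, smul_comm]
  congr 1
  rw [← intervalIntegral.integral_smul]
  simp only [mul_pow, mul_smul]

/-- Multiplication by the parameter. -/
noncomputable def mulS (V : Type) [NormedAddCommGroup V] [NormedSpace ℝ V] :
    C(unitInterval, V) →L[ℝ] C(unitInterval, V) :=
  LinearMap.mkContinuous
    { toFun := fun k => ⟨fun s => (s : ℝ) • k s, by fun_prop⟩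
      map_add' := by intros; ext; simp
      map_smul' := by intro c k; ext s; simp [smul_comm c] }
    1 (by
      intro k
      rw [ContinuousMap.norm_le _ (by positivity)]
      intro s
      simp only [LinearMap.coe_mk, AddHom.coe_mk, ContinuousMap.coe_mk]
      rw [norm_smul, Real.norm_eq_abs, abs_of_nonneg s.2.1]
      gcongr
      · exact s.2.2
      · exact k.norm_coe_le_norm s)

lemma mulS_apply (k : C(unitInterval, V)) (s : unitInterval) : mulS V k s = (s : ℝ) • k s := rfl

/-- Constant curves. -/
noncomputable def constC (V : Type) [NormedAddCommGroup V] [NormedSpace ℝ V] :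
    V →L[ℝ] C(unitInterval, V) :=
  LinearMap.mkContinuous
    { toFun := fun v => ContinuousMap.const _ v
      map_add' := by intros; ext; simp
      map_smul' := by intros; ext; simp }
    1 (by
      intro k
      rw [ContinuousMap.norm_le _ (by positivity)]
      intro s
      simp)

lemma constC_apply (v : V) (s : unitInterval) : constC V v s = v := rfl

/-- Evaluation of curves. -/
noncomputable def evC (V : Type) [NormedAddCommGroup V] [NormedSpace ℝ V] (s : unitInterval) :
    C(unitInterval, V) →L[ℝ] V :=
  LinearMap.mkContinuous
    { toFun := fun k => k s
      map_add' := by intros; simp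
      map_smul' := by intros; simp }
    1 (by
      intro k
      simpa using k.norm_coe_le_norm s)

lemma evC_apply (k : C(unitInterval, V)) (s : unitInterval) : evC V s k = k s := rfl

/-- Hadamard's lemma. -/
lemma hadamard [CompleteSpace F] (f : V → F) (hf : ContDiff ℝ (⊤ : ℕ∞) f) :
    ∃ C : V → V →L[ℝ] F, ContDiff ℝ (⊤ : ℕ∞) C ∧ (∀ x, f x = f 0 + C x x) ∧
      C 0 = fderiv ℝ f 0 := by
  have hd : Differentiable ℝ f := hf.differentiable (by simp)
  have hf' : ContDiff ℝ (⊤ : ℕ∞) (fderiv ℝ f) := hf.fderiv_right (by simp)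
  let f' : C(V, V →L[ℝ] F) := ⟨fderiv ℝ f, hf'.continuous⟩
  have hext : ∀ x : V, ∀ θ ∈ uIcc (0 : ℝ) 1,
      extC (nem f' (mulS V (constC V x))) θ = fderiv ℝ f (θ • x) := by
    intro x θ hθ
    rw [uIcc_of_le zero_le_one] at hθ
    exact extC_of_mem (nem f' (mulS V (constC V x))) ⟨θ, hθ⟩
  have hC : ∀ x, evC _ 1 (intL 0 _ (nem f' (mulS V (constC V x)))) =
      ∫ θ in (0 : ℝ)..1, fderiv ℝ f (θ • x) := by
    intro x
    rw [evC_apply, intL_apply]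
    simp only [pow_zero, one_smul, Icc.coe_one, one_mul]
    exact intervalIntegral.integral_congr (hext x)
  have hcont : Continuous (fderiv ℝ f) := hf'.continuous
  refine ⟨fun x => evC _ 1 (intL 0 _ (nem f' (mulS V (constC V x)))), ?_, ?_, ?_⟩
  · exact (evC _ 1).contDiff.comp ((intL 0 _).contDiff.comp ((nem_contDiff f' hf').comp
      ((mulS V).contDiff.comp (constC V).contDiff)))
  · intro x
    beta_reduce
    rw [hC, ContinuousLinearMap.intervalIntegral_apply
      (Continuous.intervalIntegrable (by fun_prop) _ _)]
    rw [intervalIntegral.integral_eq_sub_of_hasDerivAt (f := fun θ : ℝ => f (θ • x))]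
    · simp
    · intro θ _
      have h1 : HasDerivAt (fun θ : ℝ => θ • x) x θ := by
        simpa using (hasDerivAt_id θ).smul_const x
      exact (hd (θ • x)).hasFDerivAt.comp_hasDerivAt θ h1
    · exact Continuous.intervalIntegrable (by fun_prop) _ _
  · simp only [hC]
    simp

end curves

section core
set_option linter.unusedSectionVars false

variable {V W : Type} [NormedAddCommGroup V] [NormedSpace ℝ V] [CompleteSpace V]
  [NormedAddCommGroup W] [NormedSpace ℝ W] [CompleteSpace W]

lemma inv_smooth {E : Type} [NormedAddCommGroup E] [NormedSpace ℝ E] [CompleteSpace E]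
    (H : OpenPartialHomeomorph E E) (a : E) (ha : a ∈ H.source)
    (hs : ∀ᶠ z in 𝓝 a, ContDiffAt ℝ (⊤ : ℕ∞) H z) (H' : E ≃L[ℝ] E)
    (hd : HasFDerivAt H (H' : E →L[ℝ] E) a) :
    ∀ᶠ y in 𝓝 (H a), ContDiffAt ℝ (⊤ : ℕ∞) H.symm y := by
  have hc : ContinuousAt (fderiv ℝ H) a := by
    have h1 : ContDiffAt ℝ 1 H a := hs.self_of_nhds.of_le (by exact_mod_cast le_top)
    exact (h1.fderiv_right (m := 0) (by simp)).continuousAt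
  have hin : ∀ᶠ z in 𝓝 a, fderiv ℝ H z ∈ Set.range ((↑) : (E ≃L[ℝ] E) → (E →L[ℝ] E)) := by
    apply hc.eventually_mem
    rw [hd.fderiv]
    exact ContinuousLinearEquiv.nhds H'
  have hsc : Tendsto H.symm (𝓝 (H a)) (𝓝 a) := by
    have := (H.continuousAt_symm (H.map_source ha)).tendsto
    rwa [H.left_inv ha] at this
  filter_upwards [hsc.eventually hs, hsc.eventually hin,
    H.open_target.mem_nhds (H.map_source ha)] with y h1 h2 h3
  obtain ⟨L, hL⟩ := h2
  refine H.contDiffAt_symm h3 (f₀' := L) ?_ h1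
  rw [hL]
  exact (h1.differentiableAt (by simp)).hasFDerivAt

lemma implicit_aux (G : V × W → W) (hG : ContDiff ℝ (⊤ : ℕ∞) G) (hG0 : G 0 = 0) (c : V →L[ℝ] W)
    (hGd : HasFDerivAt G (ContinuousLinearMap.snd ℝ V W - c.comp (ContinuousLinearMap.fst ℝ V W)) 0) :
    ∃ gg : V → W, gg 0 = 0 ∧ (∀ᶠ u in 𝓝 0, ContDiffAt ℝ (⊤ : ℕ∞) gg u) ∧ (∀ᶠ u in 𝓝 0, G (u, gg u) = 0) ∧
      HasFDerivAt gg c 0 ∧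
      ∀ᶠ u in 𝓝 0, ∀ δ J, fderiv ℝ G (u, gg u) (δ, J) = 0 → fderiv ℝ gg u δ = J := by
  have hGdiff : Differentiable ℝ G := hG.differentiable (by simp)
  let Ψ : V × W → V × W := fun z => (z.1, G z)
  have hΨ : ContDiffAt ℝ (⊤ : ℕ∞) Ψ 0 := (contDiff_fst.prodMk hG).contDiffAt
  let Ψ' : (V × W) ≃L[ℝ] (V × W) := ContinuousLinearEquiv.equivOfInverse
    ((ContinuousLinearMap.fst ℝ V W).prod
      (ContinuousLinearMap.snd ℝ V W - c.comp (ContinuousLinearMap.fst ℝ V W)))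
    ((ContinuousLinearMap.fst ℝ V W).prod
      (ContinuousLinearMap.snd ℝ V W + c.comp (ContinuousLinearMap.fst ℝ V W)))
    (by intro x; ext <;> simp) (by intro x; ext <;> simp)
  have hΨ' : HasFDerivAt Ψ (Ψ' : (V × W) →L[ℝ] (V × W)) 0 :=
    hasFDerivAt_fst.prodMk hGd
  have hΨ0 : Ψ 0 = 0 := by simp [Ψ, hG0]
  let H := hΨ.toOpenPartialHomeomorph Ψ hΨ' (by simp)
  have hinv : ContDiffAt ℝ (⊤ : ℕ∞) (hΨ.localInverse hΨ' (by simp)) (Ψ 0) :=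
    hΨ.to_localInverse hΨ' (by simp)
  rw [hΨ0] at hinv
  have hinv0 : hΨ.localInverse hΨ' (by simp) 0 = 0 := by
    have := hΨ.localInverse_apply_image hΨ' (by simp)
    rwa [hΨ0] at this
  have hlocal : ∀ z, hΨ.localInverse hΨ' (by simp) z = H.symm z := fun z => rfl
  let gg : V → W := fun u => (hΨ.localInverse hΨ' (by simp) (u, 0)).2
  have hgg0 : gg 0 = 0 := by
    change (hΨ.localInverse hΨ' (by simp) 0).2 = 0
    rw [hinv0]; rfl
  have hgg : ContDiffAt ℝ (⊤ : ℕ∞) gg 0 := by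
    have h1 : ContDiffAt ℝ (⊤ : ℕ∞) (fun u : V => ((u, 0) : V × W)) 0 :=
      (contDiff_id.prodMk contDiff_const).contDiffAt
    exact contDiffAt_snd.comp (0 : V) (ContDiffAt.comp (0 : V) hinv h1)
  have hcont : Continuous (fun u : V => ((u, 0) : V × W)) := by fun_prop
  have hggs : ∀ᶠ u in 𝓝 (0 : V), ContDiffAt ℝ (⊤ : ℕ∞) gg u := by
    have h0 : ∀ᶠ y in 𝓝 (Ψ 0), ContDiffAt ℝ (⊤ : ℕ∞) H.symm y :=
      inv_smooth H 0 (hΨ.mem_toOpenPartialHomeomorph_source hΨ' (by simp))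
        (Eventually.of_forall fun z => (contDiff_fst.prodMk hG).contDiffAt) Ψ' hΨ'
    rw [hΨ0] at h0
    have h1 : ∀ᶠ u in 𝓝 (0 : V), ContDiffAt ℝ (⊤ : ℕ∞) H.symm ((u, 0) : V × W) :=
      hcont.continuousAt (x := 0) h0
    filter_upwards [h1] with u hu
    exact contDiffAt_snd.comp u (ContDiffAt.comp u hu
      (contDiff_id.prodMk contDiff_const).contDiffAt)
  have hev : ∀ᶠ u in 𝓝 (0 : V), G (u, gg u) = 0 := by
    have ht : H.target ∈ 𝓝 ((0 : V), (0 : W)) := by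
      have := hΨ.image_mem_toOpenPartialHomeomorph_target hΨ' (by simp)
      rw [hΨ0] at this
      exact H.open_target.mem_nhds this
    filter_upwards [hcont.continuousAt (x := 0) ht] with u hu
    have h2 : Ψ (H.symm (u, 0)) = (u, 0) := H.right_inv hu
    have h3 : (H.symm (u, 0)).1 = u := congrArg Prod.fst h2
    have h4 : G (H.symm (u, 0)) = 0 := congrArg Prod.snd h2
    have h5 : (u, gg u) = H.symm (u, 0) := Prod.ext h3.symm rfl
    rw [h5, h4]
  have hder : ∀ u, (∀ᶠ u in 𝓝 u, G (u, gg u) = 0) → DifferentiableAt ℝ gg u → ∀ δ,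
      fderiv ℝ G (u, gg u) (δ, fderiv ℝ gg u δ) = 0 := by
    intro u hu hd δ
    have h1 : HasFDerivAt (fun u => G (u, gg u))
        ((fderiv ℝ G (u, gg u)).comp ((ContinuousLinearMap.id ℝ V).prod (fderiv ℝ gg u))) u :=
      HasFDerivAt.comp u (hGdiff (u, gg u)).hasFDerivAt ((hasFDerivAt_id u).prodMk hd.hasFDerivAt)
    have h2 : HasFDerivAt (fun u => G (u, gg u)) (0 : V →L[ℝ] W) u :=
      (hasFDerivAt_const (0 : W) u).congr_of_eventuallyEq hu
    have := DFunLike.congr_fun (h1.unique h2) δ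
    simpa using this
  have hdiff : ∀ᶠ u in 𝓝 (0 : V), DifferentiableAt ℝ gg u := by
    have h1 : ContDiffAt ℝ 1 gg 0 := hgg.of_le (by exact_mod_cast le_top)
    filter_upwards [h1.eventually (by simp)] with u hu
    exact hu.differentiableAt (by simp)
  refine ⟨gg, hgg0, hggs, hev, ?_, ?_⟩
  · have h0 := hdiff.self_of_nhds
    convert h0.hasFDerivAt using 1
    ext δ
    have h1 := hder 0 hev h0 δ
    rw [hgg0, show ((0 : V), (0 : W)) = 0 from rfl, hGd.fderiv] at h1
    simp at h1
    exact (sub_eq_zero.1 h1).symm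
  · have hc : ContinuousAt (fun u => fderiv ℝ G (u, gg u)) 0 := by
      have h1 : Continuous (fderiv ℝ G) := hG.continuous_fderiv (by simp)
      exact h1.continuousAt.comp (continuousAt_id.prodMk hgg.continuousAt)
    have hn := Metric.continuousAt_iff'.1 hc (1 / 2) (by norm_num)
    filter_upwards [hn, hdiff, hev.eventually_nhds] with u h1 h2 h3 δ J hJ
    have h4 := hder u h3 h2 δ
    rw [hgg0, show ((0 : V), (0 : W)) = 0 from rfl, hGd.fderiv, dist_eq_norm] at h1
    set D := fderiv ℝ G (u, gg u)
    have h5 : D (0, J - fderiv ℝ gg u δ) = 0 := by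
      have : ((0 : V), J - fderiv ℝ gg u δ) = (δ, J) - (δ, fderiv ℝ gg u δ) := by simp
      rw [this, map_sub, hJ, h4, sub_zero]
    have h6 := (D - (ContinuousLinearMap.snd ℝ V W - c.comp (ContinuousLinearMap.fst ℝ V W))).le_opNorm
      (0, J - fderiv ℝ gg u δ)
    simp [h5, Prod.norm_def] at h6
    have h7 : ‖J - fderiv ℝ gg u δ‖ ≤ 1 / 2 * ‖J - fderiv ℝ gg u δ‖ := by
      rw [norm_sub_rev (fderiv ℝ gg u δ)] at h6
      exact h6.trans (mul_le_mul_of_nonneg_right h1.le (norm_nonneg _))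
    have h8 : ‖J - fderiv ℝ gg u δ‖ = 0 := by
      have := norm_nonneg (J - fderiv ℝ gg u δ)
      linarith
    exact (sub_eq_zero.1 (norm_eq_zero.1 h8)).symm

lemma const_aux (f : ℝ → V) (hf : Continuous f) (h : ∀ s ∈ Ioo (0 : ℝ) 1, HasDerivAt f 0 s) :
    ∀ s ∈ Icc (0 : ℝ) 1, f s = f 0 := by
  intro s hs
  have := intervalIntegral.integral_eq_sub_of_hasDerivAt_of_le (f := f) (f' := fun _ => 0)
    (a := 0) (b := s) hs.1 hf.continuousOn (fun x hx => h x ⟨hx.1, hx.2.trans_le hs.2⟩) (by simp)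
  simp at this
  exact sub_eq_zero.1 this.symm

/-- Pointwise post-composition of curves with a linear map. -/
noncomputable def postC (A : V →L[ℝ] W) : C(unitInterval, V) →L[ℝ] C(unitInterval, W) :=
  pwApply unitInterval V W (ContinuousMap.const _ A)

lemma postC_apply (A : V →L[ℝ] W) (g : C(unitInterval, V)) (s : unitInterval) :
    postC A g s = A (g s) := rfl

/-- The integral operator of the fixed point equation. -/
noncomputable def lop (P : V →L[ℝ] V) : C(unitInterval, V) →L[ℝ] C(unitInterval, V) :=
  (postC P).comp (intL 0 V) + (postC (ContinuousLinearMap.id ℝ V - P)).comp (intL 1 V)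

lemma lop_apply (P : V →L[ℝ] V) (k : C(unitInterval, V)) (s : unitInterval) :
    lop P k s = P (intL 0 V k s) + (intL 1 V k s - P (intL 1 V k s)) := rfl

lemma lop_zero (P : V →L[ℝ] V) (k : C(unitInterval, V)) : lop P k 0 = 0 := by
  simp [lop_apply, intL_apply]

lemma lop_smul (P : V →L[ℝ] V) (k : C(unitInterval, V)) (s : unitInterval) :
    (s : ℝ) • lop P k s = (s : ℝ) • P (∫ σ in (0 : ℝ)..s, extC k σ) +
      ((∫ σ in (0 : ℝ)..s, σ • extC k σ) - P (∫ σ in (0 : ℝ)..s, σ • extC k σ)) := by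
  have h0 := pow_smul_intL 0 k s
  have h1 := pow_smul_intL 1 k s
  simp only [pow_zero, one_smul, pow_one] at h0 h1
  rw [lop_apply, h0, ← h1, smul_add, smul_sub, map_smul]

lemma lop_deriv (P : V →L[ℝ] V) (hP : ∀ v, P (P v) = P v) (κ : C(unitInterval, V)) (δ : V)
    (J : C(unitInterval, V)) (hJ : J = constC V δ + lop P κ) (s : ℝ) (hs : s ∈ Ioo (0 : ℝ) 1) :
    HasDerivAt (fun σ => σ • extC J σ) (P (extC J s) + (δ - P δ) + s • extC κ s) s := by
  have hcκ := extC_continuous κ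
  have hform : ∀ σ ∈ Ioo (0 : ℝ) 1, σ • extC J σ = σ • δ + (σ • P (∫ τ in (0 : ℝ)..σ, extC κ τ) +
      ((∫ τ in (0 : ℝ)..σ, τ • extC κ τ) - P (∫ τ in (0 : ℝ)..σ, τ • extC κ τ))) := by
    intro σ hσ
    have h1 := extC_of_mem J ⟨σ, hσ.1.le, hσ.2.le⟩
    have h2 := lop_smul P κ ⟨σ, hσ.1.le, hσ.2.le⟩
    simp only at h1 h2
    rw [h1, ← h2, hJ, ContinuousMap.add_apply, constC_apply, smul_add]
  have hev : (fun σ => σ • extC J σ) =ᶠ[𝓝 s] fun σ => σ • δ + (σ • P (∫ τ in (0 : ℝ)..σ, extC κ τ) +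
      ((∫ τ in (0 : ℝ)..σ, τ • extC κ τ) - P (∫ τ in (0 : ℝ)..σ, τ • extC κ τ))) := by
    filter_upwards [isOpen_Ioo.mem_nhds hs] with σ hσ using hform σ hσ
  have hI0 : HasDerivAt (fun σ => ∫ τ in (0 : ℝ)..σ, extC κ τ) (extC κ s) s :=
    intervalIntegral.integral_hasDerivAt_right (hcκ.intervalIntegrable _ _)
      (hcκ.stronglyMeasurableAtFilter _ _) hcκ.continuousAt
  have hc1 : Continuous (fun τ : ℝ => τ • extC κ τ) := by fun_prop
  have hI1 : HasDerivAt (fun σ => ∫ τ in (0 : ℝ)..σ, τ • extC κ τ) (s • extC κ s) s :=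
    intervalIntegral.integral_hasDerivAt_right (hc1.intervalIntegrable _ _)
      (hc1.stronglyMeasurableAtFilter _ _) hc1.continuousAt
  have hPI0 := P.hasFDerivAt.comp_hasDerivAt s hI0
  have hPI1 := P.hasFDerivAt.comp_hasDerivAt s hI1
  have hD := ((hasDerivAt_id s).smul_const δ).add (((hasDerivAt_id s).smul hPI0).add (hI1.sub hPI1))
  refine (hD.congr_of_eventuallyEq hev).congr_deriv ?_
  have hs0 : s ≠ 0 := hs.1.ne'
  have h3 : P (extC J s) = P δ + P (∫ τ in (0 : ℝ)..s, extC κ τ) := by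
    have := congrArg P (hform s hs)
    simp only [map_add, map_sub, map_smul, hP, sub_self, add_zero] at this
    rw [← smul_add] at this
    exact smul_right_injective V hs0 this
  rw [h3]
  simp only [Function.comp_apply, id, one_smul, map_smul]
  abel

lemma lop_unique (P : V →L[ℝ] V) (hP : ∀ v, P (P v) = P v) (κ : C(unitInterval, V)) (δ : V)
    (J : C(unitInterval, V)) (hJ0 : J 0 = δ)
    (hJ : ∀ s ∈ Ioo (0 : ℝ) 1,
      HasDerivAt (fun σ => σ • extC J σ) (P (extC J s) + (δ - P δ) + s • extC κ s) s) :
    J = constC V δ + lop P κ := by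
  have hJ' := lop_deriv P hP κ δ _ rfl
  set J' := constC V δ + lop P κ with hJ'def
  let w := J - J'
  have hw0 : w 0 = 0 := by
    simp [w, hJ0, hJ'def, constC_apply, lop_zero]
  have hext : ∀ σ, extC w σ = extC J σ - extC J' σ := fun σ => rfl
  have hcw := extC_continuous w
  have hext0 : extC w 0 = 0 := by
    have := extC_of_mem w 0
    rw [hw0] at this
    exact this
  have hω : ∀ s ∈ Ioo (0 : ℝ) 1, HasDerivAt (fun σ => σ • extC w σ) (P (extC w s)) s := by
    intro s hs
    have h1 := (hJ s hs).sub (hJ' s hs)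
    have h2 : (fun σ => σ • extC w σ) = (fun σ => σ • extC J σ) - fun σ => σ • extC J' σ := by
      ext1 σ; simp [hext, smul_sub]
    rw [h2]
    refine h1.congr_deriv ?_
    rw [hext, map_sub]; abel
  have hA : ∀ s ∈ Icc (0 : ℝ) 1, s • extC w s - P (s • extC w s) = 0 := by
    have h1 := const_aux (fun s => s • extC w s - P (s • extC w s)) (by fun_prop) (by
      intro s hs
      have := (hω s hs).sub (P.hasFDerivAt.comp_hasDerivAt s (hω s hs))
      refine this.congr_deriv ?_
      rw [hP, sub_self])
    intro s hs
    rw [h1 s hs]; simp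
  have hB : ∀ s ∈ Icc (0 : ℝ) 1, P (extC w s) = 0 := by
    have h1 := const_aux (fun s => P (extC w s)) (by fun_prop) (by
      intro s hs
      have hs0 : s ≠ 0 := hs.1.ne'
      have h2 := (hasDerivAt_inv hs0).smul (P.hasFDerivAt.comp_hasDerivAt s (hω s hs))
      have h3 : (fun s => P (extC w s)) =ᶠ[𝓝 s]
          (fun s : ℝ => s⁻¹) • (P ∘ fun σ => σ • extC w σ) := by
        filter_upwards [isOpen_Ioo.mem_nhds hs] with σ hσ
        simp [smul_smul, inv_mul_cancel₀ hσ.1.ne']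
      refine (h2.congr_of_eventuallyEq h3).congr_deriv ?_
      simp only [Function.comp_apply, hP, map_smul, smul_smul]
      rw [← add_smul]
      have : s⁻¹ + -(s ^ 2)⁻¹ * s = 0 := by field_simp; ring
      rw [this, zero_smul])
    intro s hs
    rw [h1 s hs, hext0, map_zero]
  have hw : w = 0 := by
    ext s
    by_cases h : s = 0
    · rw [h, hw0]; rfl
    · have hs0 : (s : ℝ) ≠ 0 := fun h' => h (Subtype.ext h')
      have h1 := hA s s.2
      rw [map_smul, hB s s.2, smul_zero, sub_zero, extC_of_mem] at h1
      exact (smul_eq_zero.1 h1).resolve_left hs0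
  exact sub_eq_zero.1 hw
end core

section coretwo
set_option linter.unusedSectionVars false

variable {V : Type} [NormedAddCommGroup V] [NormedSpace ℝ V] [CompleteSpace V]

lemma kdata (P : V →L[ℝ] V) (e : V → V) (Ξ : V → V →L[ℝ] V)
    (he : ContDiff ℝ (⊤ : ℕ∞) e) (hΞ : ContDiff ℝ (⊤ : ℕ∞) Ξ) (he0 : e 0 = 0)
    (heP : fderiv ℝ e 0 = P) (hΞ0 : ∀ v, Ξ 0 v = v - P v) :
    ∃ k : V × V × V → V, ContDiff ℝ (⊤ : ℕ∞) k ∧ k 0 = 0 ∧ fderiv ℝ k 0 = 0 ∧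
      ∀ (s : ℝ) (g u : V), s • s • k (s • g, g, u) =
        e (s • g) - P (s • g) + s • (Ξ (s • g) u - (u - P u)) := by
  have hR : ContDiff ℝ (⊤ : ℕ∞) (fun x => e x - P x) := he.sub P.contDiff
  obtain ⟨C1, hC1, hC1e, hC10⟩ := hadamard _ hR
  have hC10' : C1 0 = 0 := by
    rw [hC10, fderiv_fun_sub (he.differentiable (by simp) 0) P.differentiableAt, heP, P.fderiv,
      sub_self]
  obtain ⟨B, hB, hBe, -⟩ := hadamard _ hC1
  obtain ⟨C, hC, hCe, -⟩ := hadamard _ hΞ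
  have hx : ContDiff ℝ (⊤ : ℕ∞) (fun z : V × V × V => z.1) := contDiff_fst
  have hg : ContDiff ℝ (⊤ : ℕ∞) (fun z : V × V × V => z.2.1) := contDiff_fst.comp contDiff_snd
  have hu : ContDiff ℝ (⊤ : ℕ∞) (fun z : V × V × V => z.2.2) := contDiff_snd.comp contDiff_snd
  have h1 : ContDiff ℝ (⊤ : ℕ∞) (fun z : V × V × V => B z.1 z.2.1) := (hB.comp hx).clm_apply hg
  have h2 : ContDiff ℝ (⊤ : ℕ∞) (fun z : V × V × V => C z.1 z.2.1) := (hC.comp hx).clm_apply hg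
  refine ⟨fun z => B z.1 z.2.1 z.2.1 + C z.1 z.2.1 z.2.2,
    (h1.clm_apply hg).add (h2.clm_apply hu), by simp, ?_, ?_⟩
  · have d1 := ((h1.differentiable (by simp) 0).hasFDerivAt).clm_apply
      ((hg.differentiable (by simp) 0).hasFDerivAt)
    have d2 := ((h2.differentiable (by simp) 0).hasFDerivAt).clm_apply
      ((hu.differentiable (by simp) 0).hasFDerivAt)
    refine (d1.add d2).fderiv.trans ?_
    ext z <;> simp
  · intro s g u
    have e1 : e (s • g) - P (s • g) = B (s • g) (s • g) (s • g) := by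
      have a1 := hC1e (s • g)
      have a2 := hBe (s • g)
      rw [hC10', zero_add] at a2
      simp only [he0, map_zero, sub_self, zero_add] at a1
      rw [a1, a2]
    have e2 : Ξ (s • g) u - (u - P u) = C (s • g) (s • g) u := by
      have a1 := hCe (s • g)
      rw [a1, ← hΞ0]; simp
    rw [e1, e2]
    simp

/-- The linear map `(u, g) ↦ (s ↦ (s g(s), g(s), u))`. -/
noncomputable def tripC (V : Type) [NormedAddCommGroup V] [NormedSpace ℝ V] [CompleteSpace V] :
    (V × C(unitInterval, V)) →L[ℝ] C(unitInterval, V × V × V) :=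
  (postC (ContinuousLinearMap.inl ℝ V (V × V))).comp
      ((mulS V).comp (ContinuousLinearMap.snd ℝ V _)) +
    (postC ((ContinuousLinearMap.inr ℝ V (V × V)).comp (ContinuousLinearMap.inl ℝ V V))).comp
      (ContinuousLinearMap.snd ℝ V _) +
    (postC ((ContinuousLinearMap.inr ℝ V (V × V)).comp (ContinuousLinearMap.inr ℝ V V))).comp
      ((constC V).comp (ContinuousLinearMap.fst ℝ V _))

lemma tripC_apply (z : V × C(unitInterval, V)) (s : unitInterval) :
    tripC V z s = ((s : ℝ) • z.2 s, z.2 s, z.1) := by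
  simp [tripC, postC_apply, mulS_apply, constC_apply]

lemma k_deriv (P : V →L[ℝ] V) (e : V → V) (Ξ : V → V →L[ℝ] V)
    (he : ContDiff ℝ (⊤ : ℕ∞) e) (hΞ : ContDiff ℝ (⊤ : ℕ∞) Ξ)
    (k : V × V × V → V) (hk : ContDiff ℝ (⊤ : ℕ∞) k)
    (hke : ∀ (s : ℝ) (g u : V), s • s • k (s • g, g, u) =
        e (s • g) - P (s • g) + s • (Ξ (s • g) u - (u - P u))) (s : ℝ) (g u J δ : V) :
    s • s • fderiv ℝ k (s • g, g, u) (s • J, J, δ) =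
      fderiv ℝ e (s • g) (s • J) - P (s • J) +
        s • (fderiv ℝ Ξ (s • g) (s • J) u + Ξ (s • g) δ - (δ - P δ)) := by
  have hg : HasDerivAt (fun t : ℝ => g + t • J) J 0 := by
    simpa using ((hasDerivAt_id (0 : ℝ)).smul_const J).const_add g
  have hu : HasDerivAt (fun t : ℝ => u + t • δ) δ 0 := by
    simpa using ((hasDerivAt_id (0 : ℝ)).smul_const δ).const_add u
  have hsg : HasDerivAt (fun t : ℝ => s • (g + t • J)) (s • J) 0 := hg.const_smul s
  have g0 : g + (0 : ℝ) • J = g := by simp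
  have u0 : u + (0 : ℝ) • δ = u := by simp
  have hkd : HasDerivAt (fun t : ℝ => k (s • (g + t • J), g + t • J, u + t • δ))
      (fderiv ℝ k (s • g, g, u) (s • J, J, δ)) 0 := by
    have := HasFDerivAt.comp_hasDerivAt_of_eq (0 : ℝ) (hk.differentiable (by simp)
      (s • g, g, u)).hasFDerivAt (hsg.prodMk (hg.prodMk hu)) (by simp)
    exact this
  have hed : HasDerivAt (fun t : ℝ => e (s • (g + t • J))) (fderiv ℝ e (s • g) (s • J)) 0 :=
    HasFDerivAt.comp_hasDerivAt_of_eq (0 : ℝ)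
      (he.differentiable (by simp) (s • g)).hasFDerivAt hsg (by simp)
  have hΞ1 : HasDerivAt (fun t : ℝ => Ξ (s • (g + t • J))) (fderiv ℝ Ξ (s • g) (s • J)) 0 :=
    HasFDerivAt.comp_hasDerivAt_of_eq (0 : ℝ)
      (hΞ.differentiable (by simp) (s • g)).hasFDerivAt hsg (by simp)
  have hΞd : HasDerivAt (fun t : ℝ => Ξ (s • (g + t • J)) (u + t • δ))
      (fderiv ℝ Ξ (s • g) (s • J) u + Ξ (s • g) δ) 0 := by
    have := hΞ1.clm_apply hu
    simpa only [g0, u0] using this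
  have hPd : HasDerivAt (fun t : ℝ => P (s • (g + t • J))) (P (s • J)) 0 :=
    P.hasFDerivAt.comp_hasDerivAt (0 : ℝ) hsg
  have hPu : HasDerivAt (fun t : ℝ => P (u + t • δ)) (P δ) 0 :=
    P.hasFDerivAt.comp_hasDerivAt (0 : ℝ) hu
  have hL : HasDerivAt (fun t : ℝ => s • s • k (s • (g + t • J), g + t • J, u + t • δ))
      (s • s • fderiv ℝ k (s • g, g, u) (s • J, J, δ)) 0 := (hkd.const_smul s).const_smul s
  have hRr : HasDerivAt (fun t : ℝ => e (s • (g + t • J)) - P (s • (g + t • J)) +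
      s • (Ξ (s • (g + t • J)) (u + t • δ) - (u + t • δ - P (u + t • δ))))
      (fderiv ℝ e (s • g) (s • J) - P (s • J) +
        s • (fderiv ℝ Ξ (s • g) (s • J) u + Ξ (s • g) δ - (δ - P δ))) 0 :=
    (hed.sub hPd).add ((hΞd.sub (hu.sub hPu)).const_smul s)
  simp only [← hke] at hRr
  exact hL.unique hRr

lemma core_exists (P : V →L[ℝ] V) (hP : ∀ v, P (P v) = P v) (e : V → V) (Ξ : V → V →L[ℝ] V)
    (he : ContDiff ℝ (⊤ : ℕ∞) e) (hΞ : ContDiff ℝ (⊤ : ℕ∞) Ξ) (he0 : e 0 = 0)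
    (heP : fderiv ℝ e 0 = P) (hΞ0 : ∀ v, Ξ 0 v = v - P v) :
    ∃ gg : V → C(unitInterval, V), gg 0 = 0 ∧ (∀ᶠ u in 𝓝 0, ContDiffAt ℝ (⊤ : ℕ∞) gg u) ∧
      HasFDerivAt gg (constC V) 0 ∧ ∀ᶠ u in 𝓝 0, gg u 0 = u ∧
        (∀ s ∈ Ioo (0 : ℝ) 1, ∃ v, HasDerivAt (fun σ => σ • extC (gg u) σ) v s ∧
          s • v = e (s • extC (gg u) s) + s • Ξ (s • extC (gg u) s) u) ∧
        (∀ (δ : V) (J : C(unitInterval, V)), J 0 = δ →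
          (∀ s ∈ Ioo (0 : ℝ) 1, ∃ j, HasDerivAt (fun σ => σ • extC J σ) j s ∧
            s • j = fderiv ℝ e (s • extC (gg u) s) (s • extC J s) +
              s • fderiv ℝ Ξ (s • extC (gg u) s) (s • extC J s) u +
              s • Ξ (s • extC (gg u) s) δ) →
          fderiv ℝ gg u δ = J) := by
  obtain ⟨k, hk, hk0, hkd0, hke⟩ := kdata P e Ξ he hΞ he0 heP hΞ0
  have hk' : ContDiff ℝ (⊤ : ℕ∞) (fderiv ℝ k) := hk.fderiv_right (by simp)
  let kc : C(V × V × V, V) := ⟨k, hk.continuous⟩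
  let kc' : C(V × V × V, (V × V × V) →L[ℝ] V) := ⟨fderiv ℝ k, hk'.continuous⟩
  let G : V × C(unitInterval, V) → C(unitInterval, V) :=
    fun z => z.2 - constC V z.1 - lop P (nem kc (tripC V z))
  have hG : ContDiff ℝ (⊤ : ℕ∞) G :=
    (contDiff_snd.sub ((constC V).contDiff.comp contDiff_fst)).sub
      ((lop P).contDiff.comp ((nem_contDiff kc hk).comp (tripC V).contDiff))
  have hGd : ∀ z, HasFDerivAt G (ContinuousLinearMap.snd ℝ V C(unitInterval, V) -
      (constC V).comp (ContinuousLinearMap.fst ℝ V C(unitInterval, V)) -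
      (lop P).comp ((pwApply _ _ _ (nem kc' (tripC V z))).comp (tripC V))) z := by
    intro z
    have h1 := nem_hasFDerivAt kc kc' (fun x => (hk.differentiable (by simp) x).hasFDerivAt)
      (tripC V z)
    have h2 := HasFDerivAt.comp z h1 (tripC V).hasFDerivAt
    have h3 := (lop P).hasFDerivAt.comp z h2
    exact (hasFDerivAt_snd.sub ((constC V).hasFDerivAt.comp z hasFDerivAt_fst)).sub h3
  have hnem0 : nem kc (tripC V 0) = 0 := by
    rw [map_zero]; ext s; exact hk0
  have hnem0' : nem kc' (tripC V 0) = 0 := by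
    rw [map_zero]; ext1 s; exact hkd0
  have hG0 : G 0 = 0 := by
    simp only [G]; rw [hnem0]; simp
  have hGd0 := hGd 0
  rw [hnem0', map_zero, ContinuousLinearMap.zero_comp, ContinuousLinearMap.comp_zero,
    sub_zero] at hGd0
  obtain ⟨gg, hgg0, hggc, hggG, hggd, hggJ⟩ := implicit_aux G hG hG0 (constC V) hGd0
  refine ⟨gg, hgg0, hggc, hggd, ?_⟩
  filter_upwards [hggG, hggJ] with u hu hJu
  have hfix : gg u = constC V u + lop P (nem kc (tripC V (u, gg u))) := by
    have : gg u - constC V u - lop P (nem kc (tripC V (u, gg u))) = 0 := hu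
    rw [sub_sub] at this
    exact sub_eq_zero.1 this
  refine ⟨?_, ?_, ?_⟩
  · conv_lhs => rw [hfix]
    rw [ContinuousMap.add_apply, lop_zero, constC_apply, add_zero]
  · intro s hs
    refine ⟨_, lop_deriv P hP _ u _ hfix s hs, ?_⟩
    have h1 : extC (nem kc (tripC V (u, gg u))) s = k (s • extC (gg u) s, extC (gg u) s, u) := by
      have a1 := extC_of_mem (nem kc (tripC V (u, gg u))) ⟨s, hs.1.le, hs.2.le⟩
      have a2 := extC_of_mem (gg u) ⟨s, hs.1.le, hs.2.le⟩
      have a3 := tripC_apply (u, gg u) ⟨s, hs.1.le, hs.2.le⟩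
      simp only at a1 a2 a3
      rw [a1, a2, ← a3]; rfl
    rw [smul_add, smul_add, h1, hke, smul_sub s (Ξ _ u), map_smul]
    abel
  · intro δ J hJ0 hJ
    apply hJu
    rw [(hGd (u, gg u)).fderiv]
    set κ : C(unitInterval, V) := pwApply _ _ _ (nem kc' (tripC V (u, gg u))) (tripC V (δ, J))
      with hκ
    have hmain : J = constC V δ + lop P κ := by
      apply lop_unique P hP κ δ J hJ0
      intro s hs
      obtain ⟨j, hj, hje⟩ := hJ s hs
      refine hj.congr_deriv ?_
      apply smul_right_injective V hs.1.ne'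
      have h1 : extC κ s = fderiv ℝ k (s • extC (gg u) s, extC (gg u) s, u)
          (s • extC J s, extC J s, δ) := by
        have a1 := extC_of_mem κ ⟨s, hs.1.le, hs.2.le⟩
        have a2 := extC_of_mem (gg u) ⟨s, hs.1.le, hs.2.le⟩
        have a3 := tripC_apply (u, gg u) ⟨s, hs.1.le, hs.2.le⟩
        have a4 := extC_of_mem J ⟨s, hs.1.le, hs.2.le⟩
        have a5 := tripC_apply (δ, J) ⟨s, hs.1.le, hs.2.le⟩
        simp only at a1 a2 a3 a4 a5
        rw [a1, a2, a4, ← a3, ← a5]; rfl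
      change s • j = s • (P (extC J s) + (δ - P δ) + s • extC κ s)
      rw [hje, smul_add, smul_add, h1, k_deriv P e Ξ he hΞ k hk hke, smul_sub s (_ + _), smul_add s,
        map_smul P]
      abel
    change J - constC V δ - lop P κ = 0
    rw [sub_sub, ← hmain, sub_self]

end coretwo

section corethree
set_option linter.unusedSectionVars false

variable {V : Type} [NormedAddCommGroup V] [NormedSpace ℝ V] [CompleteSpace V]

lemma curve_small (gg : V → C(unitInterval, V)) (h0 : gg 0 = 0) (hc : ContinuousAt gg 0)
    (p : V → Prop) (hp : ∀ᶠ x in 𝓝 0, p x) :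
    ∀ᶠ u in 𝓝 0, ∀ s ∈ Icc (0 : ℝ) 1, p (s • extC (gg u) s) := by
  obtain ⟨r, hr, H⟩ := Metric.eventually_nhds_iff.1 hp
  have h1 : ∀ᶠ u in 𝓝 0, dist (gg u) (gg 0) < r := Metric.continuousAt_iff'.1 hc r hr
  filter_upwards [h1] with u hu s hs
  rw [h0, dist_zero_right] at hu
  apply H
  rw [dist_zero_right, norm_smul, Real.norm_eq_abs, abs_of_nonneg hs.1]
  calc s * ‖extC (gg u) s‖ ≤ 1 * ‖gg u‖ := by
        gcongr
        · exact hs.2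
        · exact extC_norm _ _
    _ < r := by rwa [one_mul]

lemma core_psi (P : V →L[ℝ] V) (hP : ∀ v, P (P v) = P v) (e : V → V) (Ξ : V → V →L[ℝ] V)
    (he : ContDiff ℝ (⊤ : ℕ∞) e) (hΞ : ContDiff ℝ (⊤ : ℕ∞) Ξ) (he0 : e 0 = 0)
    (heP : fderiv ℝ e 0 = P) (hΞ0 : ∀ v, Ξ 0 v = v - P v) (hΞP : ∀ x v, Ξ x (P v) = 0) :
    ∃ ψ : V → V, ψ 0 = 0 ∧ (∀ᶠ u in 𝓝 0, ContDiffAt ℝ (⊤ : ℕ∞) ψ u) ∧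
      HasFDerivAt ψ (ContinuousLinearMap.id ℝ V) 0 ∧
      (∀ Z : V → V, ContDiff ℝ (⊤ : ℕ∞) Z → Z 0 = 0 →
        (∀ v, P (fderiv ℝ Z 0 v) = fderiv ℝ Z 0 v) →
        (∀ᶠ x in 𝓝 0, fderiv ℝ e x (Z x) = fderiv ℝ Z x (e x)) →
        (∀ᶠ x in 𝓝 0, ∀ t, fderiv ℝ Ξ x (Z x) t = fderiv ℝ Z x (Ξ x t)) →
        ∀ᶠ u in 𝓝 0, fderiv ℝ ψ u (fderiv ℝ Z 0 u) = Z (ψ u)) ∧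
      (∀ τ : V, P τ = 0 →
        (∀ᶠ x in 𝓝 0, fderiv ℝ e x (Ξ x τ) = fderiv ℝ Ξ x (e x) τ) →
        (∀ᶠ x in 𝓝 0, ∀ t, fderiv ℝ Ξ x (Ξ x τ) t = fderiv ℝ Ξ x (Ξ x t) τ) →
        ∀ᶠ u in 𝓝 0, fderiv ℝ ψ u τ = Ξ (ψ u) τ) := by
  obtain ⟨gg, hgg0, hggs, hggd, hgg⟩ := core_exists P hP e Ξ he hΞ he0 heP hΞ0
  have hggc := hggs.self_of_nhds
  have hdiff : ∀ᶠ u in 𝓝 (0 : V), DifferentiableAt ℝ gg u := by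
    have h1 : ContDiffAt ℝ 1 gg 0 := hggc.of_le (by exact_mod_cast le_top)
    filter_upwards [h1.eventually (by simp)] with u hu
    exact hu.differentiableAt (by simp)
  have hψd : ∀ u, DifferentiableAt ℝ gg u → ∀ δ,
      fderiv ℝ (fun u => evC V 1 (gg u)) u δ = fderiv ℝ gg u δ 1 := by
    intro u hu δ
    have := (evC V 1).hasFDerivAt.comp u hu.hasFDerivAt
    rw [HasFDerivAt.fderiv (f := fun u => evC V 1 (gg u)) this]
    rfl
  refine ⟨fun u => evC V 1 (gg u), ?_, ?_, ?_, ?_, ?_⟩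
  · simp [hgg0]
  · filter_upwards [hggs] with u hu
    exact (evC V 1).contDiff.contDiffAt.comp u hu
  · exact (evC V 1).hasFDerivAt.comp 0 hggd
  · intro Z hZ hZ0 hZP hZe hZΞ
    obtain ⟨C, hC, hCe, hC0⟩ := hadamard Z hZ
    let Cc : C(V, V →L[ℝ] V) := ⟨C, hC.continuous⟩
    filter_upwards [hgg, hdiff, curve_small gg hgg0 hggc.continuousAt _ hZe,
      curve_small gg hgg0 hggc.continuousAt _ hZΞ] with u hu hd hb1 hb2
    obtain ⟨hu0, hu1, hu2⟩ := hu
    set g := gg u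
    let J : C(unitInterval, V) := pwApply _ _ _ (nem Cc (mulS V g)) g
    have hJ : ∀ s : unitInterval, (s : ℝ) • J s = Z ((s : ℝ) • g s) := by
      intro s
      rw [hCe, hZ0, zero_add, map_smul]
      rfl
    have hJ0 : J 0 = fderiv ℝ Z 0 u := by
      have : J 0 = C ((0 : ℝ) • g 0) (g 0) := rfl
      rw [this, zero_smul, hC0, hu0]
    have hJe : ∀ s ∈ Icc (0 : ℝ) 1, s • extC J s = Z (s • extC g s) := by
      intro s hs
      have a1 := extC_of_mem J ⟨s, hs⟩
      have a2 := extC_of_mem g ⟨s, hs⟩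
      have a3 := hJ ⟨s, hs⟩
      simp only at a1 a2 a3
      rw [a1, a2, a3]
    have key := hu2 _ J hJ0 (by
      intro s hs
      have hs' : s ∈ Icc (0 : ℝ) 1 := ⟨hs.1.le, hs.2.le⟩
      obtain ⟨v, hv, hve⟩ := hu1 s hs
      refine ⟨fderiv ℝ Z (s • extC g s) v, ?_, ?_⟩
      · have h1 := (hZ.differentiable (by simp) (s • extC g s)).hasFDerivAt.comp_hasDerivAt s hv
        refine h1.congr_of_eventuallyEq ?_
        filter_upwards [isOpen_Ioo.mem_nhds hs] with σ hσ
        exact hJe σ ⟨hσ.1.le, hσ.2.le⟩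
      · rw [← map_smul, hve, map_add, map_smul, hJe s hs', hb1 s hs', hb2 s hs', ← hZP u, hΞP,
          smul_zero, add_zero])
    rw [hψd u hd, key]
    have := hJ 1
    simpa [evC_apply] using this
  · intro τ hτ hbe hbΞ
    let Ξc : C(V, V →L[ℝ] V) := ⟨Ξ, hΞ.continuous⟩
    filter_upwards [hgg, hdiff, curve_small gg hgg0 hggc.continuousAt _ hbe,
      curve_small gg hgg0 hggc.continuousAt _ hbΞ] with u hu hd hb1 hb2
    obtain ⟨hu0, hu1, hu2⟩ := hu
    set g := gg u
    let J : C(unitInterval, V) := pwApply _ _ _ (nem Ξc (mulS V g)) (constC V τ)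
    have hJ : ∀ s : unitInterval, J s = Ξ ((s : ℝ) • g s) τ := fun s => rfl
    have hJ0 : J 0 = τ := by
      rw [hJ]
      simp [hΞ0, hτ]
    have hJe : ∀ s ∈ Icc (0 : ℝ) 1, extC J s = Ξ (s • extC g s) τ := by
      intro s hs
      have a1 := extC_of_mem J ⟨s, hs⟩
      have a2 := extC_of_mem g ⟨s, hs⟩
      simp only at a1 a2
      rw [a1, a2, hJ]
    have key := hu2 _ J hJ0 (by
      intro s hs
      have hs' : s ∈ Icc (0 : ℝ) 1 := ⟨hs.1.le, hs.2.le⟩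
      obtain ⟨v, hv, hve⟩ := hu1 s hs
      refine ⟨s • fderiv ℝ Ξ (s • extC g s) v τ + Ξ (s • extC g s) τ, ?_, ?_⟩
      · have h1 := (hΞ.differentiable (by simp) (s • extC g s)).hasFDerivAt.comp_hasDerivAt s hv
        have h2 := (hasDerivAt_id s).smul (h1.clm_apply (hasDerivAt_const s τ))
        refine (h2.congr_of_eventuallyEq ?_).congr_deriv (by simp)
        filter_upwards [isOpen_Ioo.mem_nhds hs] with σ hσ
        simp only [hJe σ ⟨hσ.1.le, hσ.2.le⟩]
        rfl
      · have h3 : s • fderiv ℝ Ξ (s • extC g s) v τ =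
            fderiv ℝ e (s • extC g s) (Ξ (s • extC g s) τ) +
              s • fderiv ℝ Ξ (s • extC g s) (Ξ (s • extC g s) τ) u := by
          rw [hb1 s hs', hb2 s hs' u, ← ContinuousLinearMap.smul_apply, ← map_smul, hve]
          simp
        rw [smul_add, h3, hJe s hs', smul_add]
        simp only [map_smul, ContinuousLinearMap.smul_apply])
    rw [hψd u hd, key, hJ]
    simp [evC_apply]

/-- Smooth extension of a germ. -/
lemma cutoff {n : ℕ} {F : Type} [NormedAddCommGroup F] [NormedSpace ℝ F]
    (f : (Fin n → ℝ) → F) (U : Set (Fin n → ℝ)) (hU : IsOpen U) (p : Fin n → ℝ) (hp : p ∈ U)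
    (hf : ContDiffOn ℝ (⊤ : ℕ∞) f U) :
    ∃ f' : (Fin n → ℝ) → F, ContDiff ℝ (⊤ : ℕ∞) f' ∧ f' =ᶠ[𝓝 p] f := by
  obtain ⟨r, hr, hball⟩ := Metric.isOpen_iff.1 hU p hp
  let χ : ContDiffBump p := ⟨r / 4, r / 2, by positivity, by linarith⟩
  refine ⟨fun x => χ x • f x, ?_, ?_⟩
  · rw [contDiff_iff_contDiffAt]
    intro x
    by_cases hx : x ∈ U
    · exact χ.contDiff.contDiffAt.smul (hf.contDiffAt (hU.mem_nhds hx))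
    · have h0 : x ∉ tsupport χ := by
        rw [χ.tsupport_eq]
        intro h
        apply hx
        apply hball
        have h' : dist x p ≤ r / 2 := h
        exact lt_of_le_of_lt h' (by linarith)
      have h1 : (fun x => χ x • f x) =ᶠ[𝓝 x] fun _ => 0 := by
        have := notMem_tsupport_iff_eventuallyEq.1 h0
        filter_upwards [this] with y hy
        simp [hy]
      exact contDiffAt_const.congr_of_eventuallyEq h1
  · filter_upwards [χ.eventuallyEq_one] with y hy
    simp [hy]

end corethree

section algebra

lemma alg_structure (A : Type*) [CommRing A] [Algebra ℝ A] [Module.Finite ℝ A] [IsReduced A] :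
    ∃ h e : ℕ, h + 2 * e = Module.finrank ℝ A ∧
      Nonempty (A ≃ₐ[ℝ] (Fin h → ℝ) × (Fin e → ℂ)) := by
  classical
  haveI : IsArtinianRing A := IsArtinianRing.of_finite ℝ A
  let K := MaximalSpectrum A
  haveI : Fintype K := Fintype.ofFinite K
  let E := (IsArtinianRing.equivPi A)
  have hE : ∀ a I, E a I = Ideal.Quotient.mk I.asIdeal a := fun a I => rfl
  have hor : ∀ I : K, Nonempty ((A ⧸ I.asIdeal) ≃ₐ[ℝ] ℝ) ∨ Nonempty ((A ⧸ I.asIdeal) ≃ₐ[ℝ] ℂ) := by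
    intro I
    letI : Field (A ⧸ I.asIdeal) := Ideal.Quotient.field _
    haveI : Module.Finite ℝ (A ⧸ I.asIdeal) := inferInstance
    haveI : Algebra.IsAlgebraic ℝ (A ⧸ I.asIdeal) := Algebra.IsAlgebraic.of_finite _ _
    exact Real.nonempty_algEquiv_or (A ⧸ I.asIdeal)
  let K1 := {I : K // Nonempty ((A ⧸ I.asIdeal) ≃ₐ[ℝ] ℝ)}
  let K2 := {I : K // ¬ Nonempty ((A ⧸ I.asIdeal) ≃ₐ[ℝ] ℝ)}
  let e1 : ∀ I : K1, (A ⧸ I.1.asIdeal) ≃ₐ[ℝ] ℝ := fun I => I.2.some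
  let e2 : ∀ I : K2, (A ⧸ I.1.asIdeal) ≃ₐ[ℝ] ℂ := fun I => ((hor I.1).resolve_left I.2).some
  let σ1 := Fintype.equivFin K1
  let σ2 := Fintype.equivFin K2
  let Φ : A →ₐ[ℝ] (Fin (Fintype.card K1) → ℝ) × (Fin (Fintype.card K2) → ℂ) :=
    AlgHom.prod
      (AlgHom.pi fun i => ((e1 (σ1.symm i)).toAlgHom).comp (Ideal.Quotient.mkₐ ℝ (σ1.symm i).1.asIdeal))
      (AlgHom.pi fun i => ((e2 (σ2.symm i)).toAlgHom).comp (Ideal.Quotient.mkₐ ℝ (σ2.symm i).1.asIdeal))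
  have hΦ1 : ∀ a i, (Φ a).1 i = e1 (σ1.symm i) (Ideal.Quotient.mk _ a) := fun a i => rfl
  have hΦ2 : ∀ a i, (Φ a).2 i = e2 (σ2.symm i) (Ideal.Quotient.mk _ a) := fun a i => rfl
  have hbij : Function.Bijective Φ := by
    constructor
    · intro a b hab
      apply E.injective
      funext I
      rw [hE, hE]
      by_cases hI : Nonempty ((A ⧸ I.asIdeal) ≃ₐ[ℝ] ℝ)
      · have := congrFun (congrArg Prod.fst hab) (σ1 ⟨I, hI⟩)
        rw [hΦ1, hΦ1, σ1.symm_apply_apply] at this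
        exact (e1 ⟨I, hI⟩).injective this
      · have := congrFun (congrArg Prod.snd hab) (σ2 ⟨I, hI⟩)
        rw [hΦ2, hΦ2, σ2.symm_apply_apply] at this
        exact (e2 ⟨I, hI⟩).injective this
    · rintro ⟨x, y⟩
      let z : ∀ I : K, A ⧸ I.asIdeal := fun I =>
        if hI : Nonempty ((A ⧸ I.asIdeal) ≃ₐ[ℝ] ℝ) then (e1 ⟨I, hI⟩).symm (x (σ1 ⟨I, hI⟩))
        else (e2 ⟨I, hI⟩).symm (y (σ2 ⟨I, hI⟩))
      obtain ⟨a, ha⟩ := E.surjective z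
      refine ⟨a, Prod.ext ?_ ?_⟩
      · funext i
        obtain ⟨I, rfl⟩ := σ1.surjective i
        rw [hΦ1, σ1.symm_apply_apply, ← hE, ha]
        have : z I.1 = (e1 I).symm (x (σ1 I)) := dif_pos I.2
        rw [this, AlgEquiv.apply_symm_apply]
      · funext i
        obtain ⟨I, rfl⟩ := σ2.surjective i
        rw [hΦ2, σ2.symm_apply_apply, ← hE, ha]
        have : z I.1 = (e2 I).symm (y (σ2 I)) := dif_neg I.2
        rw [this, AlgEquiv.apply_symm_apply]
  let Θ := AlgEquiv.ofBijective Φ hbij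
  refine ⟨Fintype.card K1, Fintype.card K2, ?_, ⟨Θ⟩⟩
  rw [Θ.toLinearEquiv.finrank_eq, Module.finrank_prod, Module.finrank_pi_fintype,
    Module.finrank_pi_fintype]
  simp [Complex.finrank_real_complex, mul_comm]

/-- The linear coordinates on `ℝ^h × ℂ^e`. -/
noncomputable def modelT (m h e : ℕ) (hm : h + 2 * e = m) :
    (Fin m → ℝ) →ₗ[ℝ] (Fin h → ℝ) × (Fin e → ℂ) where
  toFun y := (fun i => y ⟨i, by omega⟩,
    fun j => ⟨y ⟨h + 2 * j, by omega⟩, y ⟨h + 2 * j + 1, by omega⟩⟩)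
  map_add' x y := by
    ext i
    · rfl
    · rfl
  map_smul' c y := by
    ext i
    · rfl
    · apply Complex.ext <;> simp

lemma modelT_injective (m h e : ℕ) (hm : h + 2 * e = m) : Function.Injective (modelT m h e hm) := by
  rw [injective_iff_map_eq_zero]
  intro y hy
  funext ⟨i, hi⟩
  by_cases hih : i < h
  · exact congrFun (congrArg Prod.fst hy) ⟨i, hih⟩
  · have h2 := congrFun (congrArg Prod.snd hy) ⟨(i - h) / 2, by omega⟩
    have hre := congrArg Complex.re h2
    have him := congrArg Complex.im h2
    simp only [modelT, LinearMap.coe_mk, AddHom.coe_mk] at hre him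
    rcases Nat.mod_two_eq_zero_or_one (i - h) with h0 | h0
    · have : h + 2 * ((i - h) / 2) = i := by omega
      simp only [this] at hre
      exact hre
    · have : h + 2 * ((i - h) / 2) + 1 = i := by omega
      simp only [this] at him
      exact him

lemma modelT_mul (n m h e : ℕ) (hm : h + 2 * e = m) (hmn : m ≤ n) (i : Fin m) (y : Fin n → ℝ) :
    modelT m h e hm (Pi.single i 1) * modelT m h e hm (fun j => y (Fin.castLE hmn j)) =
      modelT m h e hm (fun j => modelVF n m h (Fin.castLE hmn i) y (Fin.castLE hmn j)) := by
  obtain ⟨i, hi⟩ := i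
  have key : ∀ j : Fin m, modelVF n m h (Fin.castLE hmn ⟨i, hi⟩) y (Fin.castLE hmn j) =
      if i < h then (if (j : ℕ) = i then y (Fin.castLE hmn j) else 0)
      else if (i - h) % 2 = 0 then
        (if (j : ℕ) = i ∨ (j : ℕ) = i + 1 then y (Fin.castLE hmn j) else 0)
      else (if (j : ℕ) = i then y ⟨i - 1, by omega⟩ else if (j : ℕ) + 1 = i then
        - y ⟨i, by omega⟩ else 0) := by
    rintro ⟨j, hj⟩
    simp only [modelVF, Fin.castLE_mk, hi, dif_pos]
    by_cases h1 : i < h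
    · simp only [h1, if_true, Pi.single_apply, Fin.mk.injEq]
      split_ifs with h2
      · subst h2; rfl
      · rfl
    · have hn : i + 1 < n ∨ (i - h) % 2 ≠ 0 := by omega
      simp only [h1, if_false]
      by_cases h0 : (i - h) % 2 = 0
      · have hn' : i + 1 < n := by omega
        simp only [h0, if_true, hn', dif_pos, Pi.add_apply, Pi.single_apply, Fin.mk.injEq]
        by_cases ha : j = i
        · subst ha; simp
        · by_cases hb : j = i + 1
          · subst hb; simp
          · simp [ha, hb]
      · have hp : 0 < i := by omega
        simp only [h0, if_false, hp, dif_pos, Pi.sub_apply, Pi.single_apply, Fin.mk.injEq]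
        by_cases ha : j = i
        · subst ha
          have : j ≠ j - 1 := by omega
          simp [this]
        · by_cases hb : j = i - 1
          · have hc : j + 1 = i := by omega
            have hd : i - 1 ≠ i := by omega
            simp [hb, hd]
            intro hh; omega
          · have hc : ¬ j + 1 = i := by omega
            simp [ha, hb, hc]
  simp only [key]
  refine Prod.ext (funext fun j => ?_) (funext fun j => ?_)
  · simp only [modelT, LinearMap.coe_mk, AddHom.coe_mk, Fin.castLE_mk, Prod.fst_mul,
      Pi.mul_apply, Pi.single_apply, Fin.mk.injEq]
    have := j.2
    by_cases h1 : i < h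
    · simp [h1]
    · have h2 : (j : ℕ) ≠ i := by omega
      have h3 : (j : ℕ) ≠ i + 1 := by omega
      by_cases h0 : (i - h) % 2 = 0
      · simp only [h1, h2, h3, h0, if_true, if_false, false_or, zero_mul]
      · have h4 : (j : ℕ) + 1 ≠ i := by omega
        simp [h1, h2, h3, h4]
  · have := j.2
    simp only [modelT, LinearMap.coe_mk, AddHom.coe_mk, Fin.castLE_mk, Prod.snd_mul,
      Pi.mul_apply, Pi.single_apply, Fin.mk.injEq]
    by_cases h1 : i < h
    · have e1 : h + 2 * (j : ℕ) ≠ i := by omega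
      have e2 : h + 2 * (j : ℕ) + 1 ≠ i := by omega
      apply Complex.ext <;> simp [h1, e1, e2]
    · by_cases h0 : (i - h) % 2 = 0
      · have e2 : h + 2 * (j : ℕ) + 1 ≠ i := by omega
        have e3 : h + 2 * (j : ℕ) ≠ i + 1 := by omega
        by_cases e1 : h + 2 * (j : ℕ) = i
        · apply Complex.ext <;> simp [h1, h0, e1]
        · apply Complex.ext <;> simp [h1, h0, e1, e2, e3]
      · have e1 : h + 2 * (j : ℕ) ≠ i := by omega
        have e3 : h + 2 * (j : ℕ) + 1 + 1 ≠ i := by omega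
        by_cases e2 : h + 2 * (j : ℕ) + 1 = i
        · subst e2
          apply Complex.ext <;> simp only [h1, h0, if_false] <;> simp
        · apply Complex.ext <;> simp [h1, h0, e1, e2, e3]

lemma modelVF_ge (n m h e : ℕ) (hm : h + 2 * e = m) (hmn : m ≤ n) (i : Fin m) (y : Fin n → ℝ)
    (k : Fin n) (hk : m ≤ (k : ℕ)) : modelVF n m h (Fin.castLE hmn i) y k = 0 := by
  obtain ⟨i, hi⟩ := i
  obtain ⟨k, hk'⟩ := k
  simp only at hk
  simp only [modelVF, Fin.castLE_mk]
  have h1 : k ≠ i := by omega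
  have h2 : i - h < 2 * e → (i - h) % 2 = 0 → k ≠ i + 1 := by omega
  have h3 : k ≠ i - 1 := by omega
  split_ifs <;> simp [Pi.single_apply, h1, h3]
  all_goals omega


lemma lin_normal (n m : ℕ) (hmn : m ≤ n) (Q : Type) [AddCommGroup Q] [Module ℝ Q]
    [FiniteDimensional ℝ Q] (hQ : Module.finrank ℝ Q = m) (B : Fin m → Module.End ℝ Q)
    (hc : ∀ i j, B i * B j = B j * B i) (hss : ∀ i, (B i).IsSemisimple) (v0 : Q)
    (hv0 : LinearIndependent ℝ fun i => B i v0) :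
    ∃ h e : ℕ, h + 2 * e = m ∧ ∃ (w : Fin m → Fin m → ℝ) (a : Fin m → ℝ)
      (q : Module.Basis (Fin m) ℝ Q),
      LinearIndependent ℝ (fun i => ∑ j, w i j • B j) ∧ (∑ i, a i • ∑ j, w i j • B j = 1) ∧
      ∀ i (y : Fin n → ℝ), (∑ j, w i j • B j) (∑ j, y (Fin.castLE hmn j) • q j) =
        ∑ j, modelVF n m h (Fin.castLE hmn i) y (Fin.castLE hmn j) • q j := by
  classical
  have hcS : ∀ a ∈ Set.range B, ∀ b ∈ Set.range B, a * b = b * a := by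
    rintro _ ⟨i, rfl⟩ _ ⟨j, rfl⟩; exact hc i j
  let 𝒜 := Algebra.adjoin ℝ (Set.range B)
  letI : CommRing 𝒜 := Algebra.adjoinCommRingOfComm ℝ hcS
  have hcom : ∀ a b : 𝒜, (a : Module.End ℝ Q) * b = b * a := fun a b =>
    congrArg Subtype.val (mul_comm a b)
  have hsemi : ∀ x ∈ 𝒜, Module.End.IsSemisimple x := by
    intro x hx
    induction hx using Algebra.adjoin_induction with
    | mem x hx => obtain ⟨i, rfl⟩ := hx; exact hss i
    | algebraMap r =>
      rw [Algebra.algebraMap_eq_smul_one]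
      exact Module.End.IsSemisimple_smul r Module.End.isSemisimple_id
    | add x y hx hy h1 h2 => exact h1.add_of_commute (hcom ⟨x, hx⟩ ⟨y, hy⟩) h2
    | mul x y hx hy h1 h2 => exact h1.mul_of_commute (hcom ⟨x, hx⟩ ⟨y, hy⟩) h2
  have hred : IsReduced 𝒜 := by
    constructor
    rintro ⟨x, hx⟩ ⟨k, hk⟩
    have hk' : x ^ k = 0 := congrArg Subtype.val hk
    have := Module.End.eq_zero_of_isNilpotent_isSemisimple ⟨k, hk'⟩ (hsemi x hx)
    exact Subtype.ext this
  have hfin : Module.Finite ℝ 𝒜 := inferInstance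
  have hcard : Fintype.card (Fin m) = Module.finrank ℝ Q := by simp [hQ]
  have hspan : Submodule.span ℝ (Set.range fun i => B i v0) = ⊤ :=
    hv0.span_eq_top_of_card_eq_finrank' hcard
  let β : Module.Basis (Fin m) ℝ Q := Module.Basis.mk hv0 hspan.ge
  have hβ : ∀ i, β i = B i v0 := fun i => by simp [β]
  have hmem : ∀ i, B i ∈ 𝒜 := fun i => Algebra.subset_adjoin ⟨i, rfl⟩
  let evl : 𝒜 →ₗ[ℝ] Q := (LinearMap.applyₗ v0).comp 𝒜.val.toLinearMap
  have hevl : ∀ a : 𝒜, evl a = (a : Module.End ℝ Q) v0 := fun a => rfl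
  have hinj : Function.Injective evl := by
    rw [injective_iff_map_eq_zero]
    intro a ha
    apply Subtype.ext
    apply β.ext
    intro i
    rw [hβ]
    have := congrArg (fun f => f v0) (hcom a ⟨B i, hmem i⟩)
    simp only [Module.End.mul_apply] at this
    rw [hevl] at ha
    rw [this, ha]; simp
  have hsurj : Function.Surjective evl := by
    intro x
    refine ⟨∑ i, β.repr x i • (⟨B i, hmem i⟩ : 𝒜), ?_⟩
    rw [map_sum]
    conv_rhs => rw [← β.sum_repr x]
    refine Finset.sum_congr rfl fun i _ => ?_
    rw [map_smul, hevl, hβ]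
  let EV : 𝒜 ≃ₗ[ℝ] Q := LinearEquiv.ofBijective evl ⟨hinj, hsurj⟩
  have hcomb : ∀ a : 𝒜, ∑ i, β.repr (evl a) i • B i = (a : Module.End ℝ Q) := by
    intro a
    have : ∑ i, β.repr (evl a) i • (⟨B i, hmem i⟩ : 𝒜) = a := by
      apply hinj
      rw [map_sum]
      conv_rhs => rw [← β.sum_repr (evl a)]
      refine Finset.sum_congr rfl fun i _ => ?_
      rw [map_smul, hevl ⟨B i, hmem i⟩, hβ]
    conv_rhs => rw [← this]
    simp
  obtain ⟨h, e, hhe, ⟨Θ⟩⟩ := alg_structure 𝒜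
  have hm : h + 2 * e = m := by rw [hhe, EV.finrank_eq, hQ]
  have hfr : Module.finrank ℝ (Fin m → ℝ) = Module.finrank ℝ ((Fin h → ℝ) × (Fin e → ℂ)) := by
    rw [Module.finrank_prod, Module.finrank_pi_fintype, Module.finrank_pi_fintype,
      Module.finrank_pi_fintype]
    simp [Complex.finrank_real_complex]; omega
  let T : (Fin m → ℝ) ≃ₗ[ℝ] (Fin h → ℝ) × (Fin e → ℂ) :=
    LinearEquiv.ofInjectiveOfFinrankEq (modelT m h e hm) (modelT_injective m h e hm) hfr
  have hT : ∀ y, T y = modelT m h e hm y := fun y => rfl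
  let f : Fin m → 𝒜 := fun i => Θ.symm (T (Pi.single i 1))
  let G : (Fin m → ℝ) ≃ₗ[ℝ] Q := (T.trans Θ.symm.toLinearEquiv).trans EV
  have hG : ∀ y, G y = evl (Θ.symm (T y)) := fun y => rfl
  let q : Module.Basis (Fin m) ℝ Q := (Pi.basisFun ℝ (Fin m)).map G
  have hq : ∀ y : Fin m → ℝ, ∑ j, y j • q j = G y := by
    intro y
    have : y = ∑ j, y j • (Pi.basisFun ℝ (Fin m)) j := by
      funext k; simp [Finset.sum_apply, Pi.single_apply]
    conv_rhs => rw [this]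
    rw [map_sum]
    simp [q]
  refine ⟨h, e, hm, fun i => β.repr (evl (f i)), T.symm (Θ 1), q, ?_, ?_, ?_⟩
  · simp only [hcomb]
    have h1 : LinearIndependent ℝ (fun i => q i) := q.linearIndependent
    have h2 : (fun i => q i) = (LinearMap.applyₗ v0) ∘ (fun i => ((f i : 𝒜) : Module.End ℝ Q)) := by
      funext i; simp [q, hG, f, hevl]
    rw [h2] at h1
    exact h1.of_comp _
  · simp only [hcomb]
    have h3 : Θ.symm (T (T.symm (Θ 1))) = 1 := by
      rw [LinearEquiv.apply_symm_apply, AlgEquiv.symm_apply_apply]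
    generalize T.symm (Θ 1) = s at h3
    have h1 : ∑ i, s i • f i = 1 := by
      have h2 : s = ∑ i, s i • (Pi.single i 1 : Fin m → ℝ) := by
        funext k; simp [Finset.sum_apply, Pi.single_apply]
      rw [← h3]
      conv_rhs => rw [h2, map_sum, map_sum]
      refine Finset.sum_congr rfl fun i _ => ?_
      rw [map_smul, map_smul]
    have h4 := congrArg Subtype.val h1
    simpa using h4
  · intro i y
    rw [hcomb, hq (fun j => y (Fin.castLE hmn j)),
      hq (fun j => modelVF n m h (Fin.castLE hmn i) y (Fin.castLE hmn j)), hG, hG, hT, hT,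
      ← modelT_mul, map_mul, hevl, hevl]
    rfl

end algebra

section assembly

lemma main_loc {n m h e : ℕ} (hm : h + 2 * e = m) (hmn : m ≤ n)
    (T : Fin n → (Fin n → ℝ) → (Fin n → ℝ)) (hT : ∀ i, ContDiff ℝ (⊤ : ℕ∞) (T i))
    (hcomm : ∀ i j, ∀ᶠ x in 𝓝 0, fderiv ℝ (T j) x (T i x) = fderiv ℝ (T i) x (T j x))
    (b : Module.Basis (Fin n) ℝ (Fin n → ℝ))
    (hT0 : ∀ i : Fin n, T i 0 = if (i : ℕ) < m then 0 else b i)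
    (a : Fin n → ℝ) (ha : ∀ i : Fin n, m ≤ (i : ℕ) → a i = 0)
    (hab : ∀ j : Fin n, ∑ i, a i • fderiv ℝ (T i) 0 (b j) = if (j : ℕ) < m then b j else 0)
    (hmod : ∀ i : Fin n, (i : ℕ) < m → ∀ y : Fin n → ℝ,
      fderiv ℝ (T i) 0 (∑ j, y j • b j) = ∑ j, modelVF n m h i y j • b j) :
    ∃ ψ : (Fin n → ℝ) → (Fin n → ℝ), ψ 0 = 0 ∧ (∀ᶠ u in 𝓝 0, ContDiffAt ℝ (⊤ : ℕ∞) ψ u) ∧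
      HasFDerivAt ψ (ContinuousLinearMap.id ℝ (Fin n → ℝ)) 0 ∧
      ∀ i, ∀ᶠ u in 𝓝 0, fderiv ℝ ψ u (∑ j, modelVF n m h i (b.repr u) j • b j) = T i (ψ u) := by
  classical
  have hTd : ∀ i x, DifferentiableAt ℝ (T i) x := fun i x => (hT i).differentiable (by simp) x
  let ef : (Fin n → ℝ) → (Fin n → ℝ) := fun x => ∑ i, a i • T i x
  have hef : ContDiff ℝ (⊤ : ℕ∞) ef := ContDiff.sum fun i _ => (hT i).const_smul (a i)
  have hefd : ∀ x, HasFDerivAt ef (∑ i, a i • fderiv ℝ (T i) x) x := fun x =>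
    HasFDerivAt.fun_sum fun i _ => (hTd i x).hasFDerivAt.const_smul (a i)
  have hefd' : ∀ x v, fderiv ℝ ef x v = ∑ i, a i • fderiv ℝ (T i) x v := by
    intro x v
    rw [(hefd x).fderiv]; simp
  let cc : Fin n → ((Fin n → ℝ) →L[ℝ] ℝ) := fun k =>
    (if (k : ℕ) < m then 0 else 1 : ℝ) • (b.coord k).toContinuousLinearMap
  have hcc : ∀ k v, cc k v = if (k : ℕ) < m then 0 else b.repr v k := by
    intro k v
    by_cases hk : (k : ℕ) < m <;> simp [cc, hk]
  let Ξ : (Fin n → ℝ) → (Fin n → ℝ) →L[ℝ] (Fin n → ℝ) := fun x =>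
    ∑ k, (cc k).smulRight (T k x)
  have hΞa : ∀ x v, Ξ x v = ∑ k, cc k v • T k x := by
    intro x v; simp [Ξ]
  have hΞ : ContDiff ℝ (⊤ : ℕ∞) Ξ := ContDiff.sum fun k _ =>
    (ContinuousLinearMap.smulRightL ℝ (Fin n → ℝ) (Fin n → ℝ) (cc k)).contDiff.comp (hT k)
  have hΞd : ∀ x, HasFDerivAt Ξ (∑ k, (ContinuousLinearMap.smulRightL ℝ (Fin n → ℝ) (Fin n → ℝ)
      (cc k)).comp (fderiv ℝ (T k) x)) x := fun x =>
    HasFDerivAt.fun_sum fun k _ =>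
      (ContinuousLinearMap.smulRightL ℝ (Fin n → ℝ) (Fin n → ℝ) (cc k)).hasFDerivAt.comp x
        (hTd k x).hasFDerivAt
  have hΞd' : ∀ x w t, fderiv ℝ Ξ x w t = ∑ k, cc k t • fderiv ℝ (T k) x w := by
    intro x w t
    rw [(hΞd x).fderiv]; simp
  let P := fderiv ℝ ef 0
  have hPb : ∀ j, P (b j) = if (j : ℕ) < m then b j else 0 := by
    intro j; rw [← hab j]; exact hefd' 0 (b j)
  have hPe : ∀ v, P v = ∑ j : Fin n, (if (j : ℕ) < m then b.repr v j else 0) • b j := by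
    intro v
    conv_lhs => rw [← b.sum_repr v]
    rw [map_sum]
    refine Finset.sum_congr rfl fun j _ => ?_
    rw [map_smul, hPb]
    split_ifs <;> simp
  have hPr : ∀ v j, b.repr (P v) j = if (j : ℕ) < m then b.repr v j else 0 := by
    intro v j
    rw [hPe]
    exact b.repr_sum_self (fun j : Fin n => if (j : ℕ) < m then b.repr v j else 0) ▸ rfl
  have hPP : ∀ v, P (P v) = P v := by
    intro v
    rw [hPe (P v), hPe v]
    refine Finset.sum_congr rfl fun j _ => ?_
    rw [← hPe, hPr]
    split_ifs <;> rfl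
  have hef0 : ef 0 = 0 := by
    refine Finset.sum_eq_zero fun i _ => ?_
    rw [hT0]
    split_ifs with hi
    · simp
    · rw [ha i (by omega)]; simp
  have hΞ0 : ∀ v, Ξ 0 v = v - P v := by
    intro v
    rw [eq_sub_iff_add_eq, hΞa, hPe, ← Finset.sum_add_distrib]
    refine Eq.trans (Finset.sum_congr rfl fun j _ => ?_) (b.sum_repr v)
    rw [hcc, hT0]
    split_ifs <;> simp
  have hΞP : ∀ x v, Ξ x (P v) = 0 := by
    intro x v
    rw [hΞa]
    refine Finset.sum_eq_zero fun k _ => ?_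
    rw [hcc, hPr]
    split_ifs <;> simp
  have hall : ∀ᶠ x in 𝓝 0, ∀ i j, fderiv ℝ (T j) x (T i x) = fderiv ℝ (T i) x (T j x) := by
    rw [eventually_all]; intro i
    rw [eventually_all]; intro j
    exact hcomm i j
  obtain ⟨ψ, hψ0, hψs, hψd, hψZ, hψτ⟩ := core_psi P hPP ef Ξ hef hΞ hef0 rfl hΞ0 hΞP
  refine ⟨ψ, hψ0, hψs, hψd, fun i => ?_⟩
  by_cases hi : (i : ℕ) < m
  · have hA : ∀ u, fderiv ℝ (T i) 0 u = ∑ j, modelVF n m h i (b.repr u) j • b j := by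
      intro u
      rw [← hmod i hi, b.sum_repr]
    have := hψZ (T i) (hT i) (by rw [hT0, if_pos hi]) (by
      intro v
      rw [hA, map_sum]
      refine Finset.sum_congr rfl fun j _ => ?_
      rw [map_smul, hPb]
      split_ifs with hj
      · rfl
      · have := modelVF_ge n m h e hm hmn ⟨i, hi⟩ (b.repr v) j (by omega)
        change modelVF n m h i (b.repr v) j = 0 at this
        rw [this]; simp) (by
      filter_upwards [hall] with x hx
      rw [hefd', map_sum]
      refine Finset.sum_congr rfl fun j _ => ?_
      rw [hx, map_smul]) (by
      filter_upwards [hall] with x hx t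
      rw [hΞd', hΞa, map_sum]
      refine Finset.sum_congr rfl fun j _ => ?_
      rw [hx, map_smul])
    filter_upwards [this] with u hu
    rw [← hA, hu]
  · have hΞb : ∀ x, Ξ x (b i) = T i x := by
      intro x
      rw [hΞa, Finset.sum_eq_single i]
      · rw [hcc, if_neg hi]; simp
      · intro k _ hk
        rw [hcc]
        simp [Ne.symm hk]
      · simp
    have hΞb' : ∀ x w, fderiv ℝ Ξ x w (b i) = fderiv ℝ (T i) x w := by
      intro x w
      rw [hΞd', Finset.sum_eq_single i]
      · rw [hcc, if_neg hi]; simp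
      · intro k _ hk
        rw [hcc]
        simp [Ne.symm hk]
      · simp
    have := hψτ (b i) (by rw [hPb, if_neg hi]) (by
      filter_upwards [hall] with x hx
      rw [hΞb, hΞb', hefd', map_sum]
      refine Finset.sum_congr rfl fun j _ => ?_
      rw [hx, map_smul]) (by
      filter_upwards [hall] with x hx t
      rw [hΞb, hΞb', hΞd', hΞa, map_sum]
      refine Finset.sum_congr rfl fun j _ => ?_
      rw [hx, map_smul])
    filter_upwards [this] with u hu
    rw [hΞb] at hu
    rw [← hu]
    congr 1
    have : modelVF n m h i (b.repr u) = Pi.single i 1 := by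
      have : ¬ (i : ℕ) < h := by omega
      simp [modelVF, hi, this]
    rw [this, Finset.sum_eq_single i]
    · simp
    · intro k _ hk; simp [hk]
    · simp

lemma main_chart {n : ℕ} (U : Set (Fin n → ℝ)) (hU : IsOpen U) (p₀ : Fin n → ℝ) (hp : p₀ ∈ U)
    (R N : Fin n → (Fin n → ℝ) → (Fin n → ℝ)) (β : (Fin n → ℝ) ≃L[ℝ] (Fin n → ℝ))
    (ψ0 : (Fin n → ℝ) → (Fin n → ℝ)) (h0 : ψ0 0 = 0)
    (hs : ∀ᶠ u in 𝓝 0, ContDiffAt ℝ (⊤ : ℕ∞) ψ0 u)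
    (hd : HasFDerivAt ψ0 (ContinuousLinearMap.id ℝ (Fin n → ℝ)) 0)
    (hR : ∀ i, ∀ᶠ u in 𝓝 0, fderiv ℝ ψ0 u (β (N i (β.symm u))) = R i (p₀ + ψ0 u)) :
    ∃ V W : Set (Fin n → ℝ), IsOpen V ∧ V ⊆ U ∧ p₀ ∈ V ∧
        IsOpen W ∧ (0 : Fin n → ℝ) ∈ W ∧
        ∃ φ ψ : (Fin n → ℝ) → (Fin n → ℝ),
          ContDiffOn ℝ (⊤ : ℕ∞) φ V ∧ ContDiffOn ℝ (⊤ : ℕ∞) ψ W ∧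
          Set.MapsTo φ V W ∧ Set.MapsTo ψ W V ∧
          (∀ x ∈ V, ψ (φ x) = x) ∧ (∀ y ∈ W, φ (ψ y) = y) ∧ φ '' V = W ∧ φ p₀ = 0 ∧
          ∀ i : Fin n, ∀ x ∈ V, fderiv ℝ φ x (R i x) = N i (φ x) := by
  let Ψ : (Fin n → ℝ) → (Fin n → ℝ) := fun y => p₀ + ψ0 (β y)
  have hΨ0 : Ψ 0 = p₀ := by simp [Ψ, h0]
  have hβ : Tendsto β (𝓝 0) (𝓝 0) := by
    have := β.continuous.tendsto 0
    rwa [map_zero] at this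
  have hΨs : ∀ᶠ y in 𝓝 0, ContDiffAt ℝ (⊤ : ℕ∞) Ψ y := by
    filter_upwards [hβ.eventually hs] with y hy
    exact contDiffAt_const.add (ContDiffAt.comp y hy β.contDiff.contDiffAt)
  have hΨd : HasFDerivAt Ψ (β : (Fin n → ℝ) →L[ℝ] (Fin n → ℝ)) 0 := by
    have h1 : HasFDerivAt ψ0 (ContinuousLinearMap.id ℝ (Fin n → ℝ)) (β 0) := by
      rw [map_zero]; exact hd
    exact (h1.comp 0 β.hasFDerivAt).const_add p₀
  have hΨc := hΨs.self_of_nhds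
  let H := hΨc.toOpenPartialHomeomorph Ψ hΨd (by simp)
  have hH : ∀ y, H y = Ψ y := fun y => rfl
  have hmem : (0 : Fin n → ℝ) ∈ H.source := hΨc.mem_toOpenPartialHomeomorph_source hΨd (by simp)
  have hsym : ∀ᶠ x in 𝓝 (Ψ 0), ContDiffAt ℝ (⊤ : ℕ∞) H.symm x :=
    inv_smooth H 0 hmem hΨs β hΨd
  have hΨt : Tendsto Ψ (𝓝 0) (𝓝 (Ψ 0)) := hΨc.continuousAt
  have hRall : ∀ᶠ y in 𝓝 (0 : Fin n → ℝ), ∀ i,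
      fderiv ℝ ψ0 (β y) (β (N i y)) = R i (p₀ + ψ0 (β y)) := by
    rw [eventually_all]
    intro i
    filter_upwards [hβ.eventually (hR i)] with y hy
    simpa using hy
  have hbig := (hβ.eventually hs).and (hRall.and (hΨs.and ((hΨt.eventually hsym).and
    ((hΨt.eventually (hU.mem_nhds (hΨ0.symm ▸ hp))).and (H.open_source.mem_nhds hmem)))))
  obtain ⟨W, hWsub, hWo, hW0⟩ := mem_nhds_iff.1 hbig
  have hWsrc : W ⊆ H.source := fun y hy => (hWsub hy).2.2.2.2.2
  refine ⟨H '' W, W, ?_, ?_, ⟨0, hW0, hΨ0⟩, hWo, hW0, H.symm, Ψ, ?_, ?_, ?_, ?_, ?_, ?_, ?_, ?_, ?_⟩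
  · exact H.isOpen_image_of_subset_source hWo hWsrc
  · rintro _ ⟨y, hy, rfl⟩
    exact (hWsub hy).2.2.2.2.1
  · rintro _ ⟨y, hy, rfl⟩
    exact (hWsub hy).2.2.2.1.contDiffWithinAt
  · intro y hy
    exact (hWsub hy).2.2.1.contDiffWithinAt
  · rintro _ ⟨y, hy, rfl⟩
    rw [H.left_inv (hWsrc hy)]; exact hy
  · intro y hy; exact ⟨y, hy, rfl⟩
  · rintro _ ⟨y, hy, rfl⟩
    rw [H.left_inv (hWsrc hy)]; rfl
  · intro y hy; exact H.left_inv (hWsrc hy)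
  · ext y
    constructor
    · rintro ⟨_, ⟨z, hz, rfl⟩, rfl⟩
      rw [H.left_inv (hWsrc hz)]; exact hz
    · intro hy
      exact ⟨H y, ⟨y, hy, rfl⟩, H.left_inv (hWsrc hy)⟩
  · rw [← hΨ0]; exact H.left_inv hmem
  · rintro i _ ⟨y, hy, rfl⟩
    rw [H.left_inv (hWsrc hy)]
    obtain ⟨g1, g2, g3, g4, -, -⟩ := hWsub hy
    have k1 : HasFDerivAt Ψ ((fderiv ℝ ψ0 (β y)).comp (β : (Fin n → ℝ) →L[ℝ] (Fin n → ℝ))) y :=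
      (((g1.differentiableAt (by simp)).hasFDerivAt).comp y β.hasFDerivAt).const_add p₀
    have k2 : HasFDerivAt H.symm (fderiv ℝ H.symm (Ψ y)) (Ψ y) :=
      (g4.differentiableAt (by simp)).hasFDerivAt
    have k3 := k2.comp y k1
    have k4 : HasFDerivAt (H.symm ∘ Ψ) (ContinuousLinearMap.id ℝ (Fin n → ℝ)) y := by
      refine (hasFDerivAt_id y).congr_of_eventuallyEq ?_
      filter_upwards [hWo.mem_nhds hy] with z hz
      exact H.left_inv (hWsrc hz)
    have k5 := DFunLike.congr_fun (k3.unique k4) (N i y)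
    have k6 : R i (H y) = fderiv ℝ ψ0 (β y) (β (N i y)) := (g2 i).symm
    rw [k6]
    exact k5

end assembly

section finalaux

lemma sum_split {M : Type*} [AddCommMonoid M] {n m : ℕ} (hmn : m ≤ n) (f : Fin n → M) :
    ∑ i, f i = ∑ i : Fin m, f (Fin.castLE hmn i) +
      ∑ k : Fin (n - m), f ⟨m + (k : ℕ), by omega⟩ := by
  have hn : m + (n - m) = n := by omega
  rw [← (finSumFinEquiv.trans (finCongr hn)).sum_comp f, Fintype.sum_sum_type]
  rfl

lemma comm_deriv {n : ℕ} (f g : (Fin n → ℝ) → (Fin n → ℝ)) (p : Fin n → ℝ)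
    (hf : ContDiffAt ℝ (⊤ : ℕ∞) f p) (hg : ContDiffAt ℝ (⊤ : ℕ∞) g p) (hf0 : f p = 0)
    (hg0 : g p = 0) (hb : ∀ᶠ x in 𝓝 p, fderiv ℝ f x (g x) = fderiv ℝ g x (f x)) (v : Fin n → ℝ) :
    fderiv ℝ f p (fderiv ℝ g p v) = fderiv ℝ g p (fderiv ℝ f p v) := by
  have key : ∀ f g : (Fin n → ℝ) → (Fin n → ℝ), ContDiffAt ℝ (⊤ : ℕ∞) f p →
      ContDiffAt ℝ (⊤ : ℕ∞) g p → g p = 0 →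
      HasFDerivAt (fun x => fderiv ℝ f x (g x)) ((fderiv ℝ f p).comp (fderiv ℝ g p)) p := by
    intro f g hf hg hg0
    have h1 : ContDiffAt ℝ (⊤ : ℕ∞) (fderiv ℝ f) p := hf.fderiv_right (by simp)
    have h2 := (h1.differentiableAt (by simp)).hasFDerivAt.clm_apply
      (hg.differentiableAt (by simp)).hasFDerivAt
    rw [hg0] at h2
    simpa using h2
  have h1 := key f g hf hg hg0
  have h2 := (key g f hg hf hf0).congr_of_eventuallyEq hb
  exact DFunLike.congr_fun (h1.unique h2) v

end finalaux

end helpers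

/-- Smooth geometric linearization of integrable systems of type (n,0) at a
nondegenerate singular point of corank m: in suitable smooth local coordinates
centered at the point, suitable constant linear combinations of the vector fields
take the model form with h hyperbolic components, e elbolic components
(h + 2e = m), and n - m regular (constant) components. -/
theorem smooth_linearization_type_n0_general
    (n m : ℕ) (hm0 : 0 < m) (hmn : m ≤ n)
    (U : Set (Fin n → ℝ)) (hUopen : IsOpen U)
    (p₀ : Fin n → ℝ) (hp₀ : p₀ ∈ U)
    (X : Fin n → (Fin n → ℝ) → (Fin n → ℝ))
    (hXsm : ∀ i, ContDiffOn ℝ (⊤ : ℕ∞) (X i) U)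
    (hcomm : ∀ i j, ∀ x ∈ U, fderiv ℝ (X j) x (X i x) - fderiv ℝ (X i) x (X j x) = 0)
    -- the corank at p₀ is m
    (hrank : Module.finrank ℝ (Submodule.span ℝ (Set.range fun i => X i p₀)) = n - m)
    -- after renumbering, the last n - m vector fields are independent at p₀
    (hlin : LinearIndependent ℝ fun k : Fin (n - m) => X ⟨m + (k : ℕ), by omega⟩ p₀)
    -- the combinations Z_i vanish at p₀
    (c : Fin m → Fin (n - m) → ℝ)
    (Z : Fin m → (Fin n → ℝ) → (Fin n → ℝ))
    (hZ : ∀ i x, Z i x = X ⟨(i : ℕ), by omega⟩ x -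
      ∑ k : Fin (n - m), c i k • X ⟨m + (k : ℕ), by omega⟩ x)
    (hZfix : ∀ i, Z i p₀ = 0)
    -- S is the span of the values at p₀ of the last n - m vector fields
    (S : Submodule ℝ (Fin n → ℝ))
    (hS : S = Submodule.span ℝ (Set.range fun k : Fin (n - m) =>
      X ⟨m + (k : ℕ), by omega⟩ p₀))
    -- the linear parts DZ_i(p₀) preserve S, hence induce endomorphisms of the quotient
    (hSinv : ∀ i, ∀ v ∈ S, fderiv ℝ (Z i) p₀ v ∈ S)
    (Abar : Fin m → Module.End ℝ ((Fin n → ℝ) ⧸ S))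
    (hAbar : ∀ i, (Abar i).comp S.mkQ = S.mkQ.comp (fderiv ℝ (Z i) p₀).toLinearMap)
    -- nondegeneracy: the induced endomorphisms are semisimple and the associated
    -- linear vector fields on the quotient are independent on a dense subset
    (hss : ∀ i, (Abar i).IsSemisimple)
    (hAind : Dense {v : (Fin n → ℝ) ⧸ S | LinearIndependent ℝ fun i => Abar i v}) :
    ∃ h e : ℕ, h + 2 * e = m ∧
      ∃ V W : Set (Fin n → ℝ), IsOpen V ∧ V ⊆ U ∧ p₀ ∈ V ∧
        IsOpen W ∧ (0 : Fin n → ℝ) ∈ W ∧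
        ∃ φ ψ : (Fin n → ℝ) → (Fin n → ℝ),
          ContDiffOn ℝ (⊤ : ℕ∞) φ V ∧ ContDiffOn ℝ (⊤ : ℕ∞) ψ W ∧
          Set.MapsTo φ V W ∧ Set.MapsTo ψ W V ∧
          (∀ x ∈ V, ψ (φ x) = x) ∧ (∀ y ∈ W, φ (ψ y) = y) ∧ φ '' V = W ∧ φ p₀ = 0 ∧
          ∃ v : Matrix (Fin n) (Fin n) ℝ, IsUnit v ∧
            ∀ i : Fin n, ∀ x ∈ V,
              fderiv ℝ φ x (∑ j, v i j • X j x) = modelVF n m h i (φ x) := by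
  classical
  have hmemU : ∀ᶠ x in nhds p₀, x ∈ U := hUopen.mem_nhds hp₀
  have hXat : ∀ i, ∀ x ∈ U, ContDiffAt ℝ (⊤ : ℕ∞) (X i) x := fun i x hx =>
    (hXsm i).contDiffAt (hUopen.mem_nhds hx)
  let cmb := Fintype.linearCombination ℝ X
  have hcmb : ∀ c x, cmb c x = ∑ j, c j • X j x := by
    intro c x
    simp [cmb, Fintype.linearCombination_apply, Finset.sum_apply]
  let D : (Fin n → ℝ) → (Fin n → ℝ) →ₗ[ℝ] ((Fin n → ℝ) →L[ℝ] (Fin n → ℝ)) := fun x =>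
    Fintype.linearCombination ℝ (fun i => fderiv ℝ (X i) x)
  have hD : ∀ x c v, D x c v = ∑ j, c j • fderiv ℝ (X j) x v := by
    intro x c v
    simp [D, Fintype.linearCombination_apply]
  have hcmbd : ∀ c, ∀ x ∈ U, HasFDerivAt (cmb c) (D x c) x := by
    intro c x hx
    have h1 : HasFDerivAt (fun x => ∑ j, c j • X j x) (∑ j, c j • fderiv ℝ (X j) x) x :=
      HasFDerivAt.fun_sum fun j _ =>
        ((hXat j x hx).differentiableAt (by simp)).hasFDerivAt.const_smul (c j)
    have h2 : cmb c = fun x => ∑ j, c j • X j x := funext (hcmb c)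
    rw [h2]
    exact h1
  have hcmbs : ∀ c, ContDiffOn ℝ (⊤ : ℕ∞) (cmb c) U := by
    intro c
    have h2 : cmb c = fun x => ∑ j, c j • X j x := funext (hcmb c)
    rw [h2]
    exact ContDiffOn.sum fun j _ => (hXsm j).const_smul (c j)
  have hbr : ∀ c d, ∀ x ∈ U, D x d (cmb c x) = D x c (cmb d x) := by
    intro c d x hx
    rw [hcmb, hcmb, hD, hD]
    simp only [map_sum, map_smul, Finset.smul_sum]
    rw [Finset.sum_comm]
    refine Finset.sum_congr rfl fun i _ => Finset.sum_congr rfl fun j _ => ?_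
    rw [sub_eq_zero.1 (hcomm i j x hx), smul_comm]
  have hX1 : ∀ i, cmb (Pi.single i 1) = X i := by
    intro i
    funext x
    rw [hcmb, Finset.sum_eq_single i]
    · simp
    · intro j _ hj; simp [hj]
    · simp
  let ζ : Fin m → Fin n → ℝ := fun l => Pi.single (⟨(l : ℕ), by omega⟩ : Fin n) 1 -
    ∑ k : Fin (n - m), c l k • Pi.single (⟨m + (k : ℕ), by omega⟩ : Fin n) 1
  have hζ : ∀ l, cmb (ζ l) = Z l := by
    intro l
    funext x
    simp only [ζ, map_sub, map_sum, map_smul, hX1]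
    rw [hZ]
    simp [Finset.sum_apply]
  have hfZ : ∀ l, fderiv ℝ (Z l) p₀ = D p₀ (ζ l) := by
    intro l
    rw [← hζ l]
    exact (hcmbd (ζ l) p₀ hp₀).fderiv
  let A : Fin m → ((Fin n → ℝ) →L[ℝ] (Fin n → ℝ)) := fun l => D p₀ (ζ l)
  have hAS : ∀ l, ∀ s ∈ S, A l s = 0 := by
    intro l s hs
    rw [hS] at hs
    induction hs using Submodule.span_induction with
    | mem x hx =>
      obtain ⟨k, rfl⟩ := hx
      have := hbr (Pi.single (⟨m + (k : ℕ), by omega⟩ : Fin n) 1) (ζ l) p₀ hp₀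
      rw [hX1, hζ, hZfix, map_zero] at this
      exact this
    | zero => simp
    | add x y _ _ h1 h2 => rw [map_add, h1, h2, add_zero]
    | smul r x _ h1 => rw [map_smul, h1, smul_zero]
  have hAc : ∀ i j v, A i (A j v) = A j (A i v) := by
    intro i j v
    have h1 := comm_deriv (Z i) (Z j) p₀
      (by rw [← hζ]; exact (hcmbs _).contDiffAt (hUopen.mem_nhds hp₀))
      (by rw [← hζ]; exact (hcmbs _).contDiffAt (hUopen.mem_nhds hp₀)) (hZfix i) (hZfix j)
      (by
        filter_upwards [hmemU] with x hx
        rw [← hζ, ← hζ, (hcmbd _ x hx).fderiv, (hcmbd _ x hx).fderiv]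
        exact hbr _ _ x hx) v
    rw [hfZ, hfZ] at h1
    exact h1
  have hmk : ∀ i v, Abar i (S.mkQ v) = S.mkQ (A i v) := by
    intro i v
    have := LinearMap.congr_fun (hAbar i) v
    rw [hfZ] at this
    exact this
  have hBc : ∀ i j, Abar i * Abar j = Abar j * Abar i := by
    intro i j
    apply Submodule.linearMap_qext
    refine LinearMap.ext fun v => ?_
    change Abar i (Abar j (S.mkQ v)) = Abar j (Abar i (S.mkQ v))
    rw [hmk, hmk, hmk, hmk, hAc]
  have hfS : Module.finrank ℝ S = n - m := by
    rw [hS, finrank_span_eq_card hlin, Fintype.card_fin]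
  have hQ : Module.finrank ℝ ((Fin n → ℝ) ⧸ S) = m := by
    have := Submodule.finrank_quotient_add_finrank S
    rw [hfS, Module.finrank_fin_fun] at this
    omega
  obtain ⟨v0, hv0⟩ := hAind.nonempty
  obtain ⟨h, e, hhe, w, a, q, hFind, hone, hFmod⟩ :=
    lin_normal n m hmn ((Fin n → ℝ) ⧸ S) hQ Abar hBc hss v0 hv0
  -- the new fields
  let η : Fin m → Fin n → ℝ := fun i => ∑ l, w i l • ζ l
  let AY : Fin m → ((Fin n → ℝ) →L[ℝ] (Fin n → ℝ)) := fun i => D p₀ (η i)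
  have hAY : ∀ i v, AY i v = ∑ l, w i l • A l v := by
    intro i v
    simp [AY, η, map_sum, map_smul, A]
  have hFmk : ∀ i v, (∑ j, w i j • Abar j) (S.mkQ v) = S.mkQ (AY i v) := by
    intro i v
    rw [hAY, map_sum, LinearMap.sum_apply]
    refine Finset.sum_congr rfl fun l _ => ?_
    rw [LinearMap.smul_apply, hmk, map_smul]
  let P : (Fin n → ℝ) →L[ℝ] (Fin n → ℝ) := ∑ i, a i • AY i
  have hPv : ∀ v, P v = ∑ i, a i • AY i v := by
    intro v; simp [P]
  have hAYS : ∀ i, ∀ s ∈ S, AY i s = 0 := by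
    intro i s hs
    rw [hAY]
    refine Finset.sum_eq_zero fun l _ => ?_
    rw [hAS l s hs, smul_zero]
  have hPS : ∀ s ∈ S, P s = 0 := by
    intro s hs
    rw [hPv]
    refine Finset.sum_eq_zero fun l _ => ?_
    rw [hAYS l s hs, smul_zero]
  have hPmk : ∀ v, S.mkQ (P v) = S.mkQ v := by
    intro v
    have h1 := LinearMap.congr_fun hone (S.mkQ v)
    rw [Module.End.one_apply] at h1
    rw [← h1, hPv, map_sum, LinearMap.sum_apply]
    refine Finset.sum_congr rfl fun i _ => ?_
    rw [LinearMap.smul_apply, hFmk, map_smul]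
  have hmemS : ∀ u v, S.mkQ u = S.mkQ v → u - v ∈ S := by
    intro u v huv
    exact (Submodule.Quotient.eq S).1 huv
  have hPP : ∀ v, P (P v) = P v := by
    intro v
    have := hPS _ (hmemS _ _ (hPmk v))
    rwa [map_sub, sub_eq_zero] at this
  have hAYc : ∀ i j v, AY i (AY j v) = AY j (AY i v) := by
    intro i j v
    simp only [hAY, map_sum, map_smul, Finset.smul_sum]
    rw [Finset.sum_comm]
    refine Finset.sum_congr rfl fun k _ => Finset.sum_congr rfl fun l _ => ?_
    rw [hAc, smul_comm]
  have hPA : ∀ i v, P (AY i v) = AY i v := by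
    intro i v
    have h1 : P (AY i v) = AY i (P v) := by
      rw [hPv, hPv, map_sum]
      refine Finset.sum_congr rfl fun j _ => ?_
      rw [map_smul, hAYc]
    have h2 := hAYS i _ (hmemS _ _ (hPmk v))
    rw [map_sub, sub_eq_zero] at h2
    rw [h1, h2]
  have hPeq : ∀ u v, P u = u → P v = v → S.mkQ u = S.mkQ v → u = v := by
    intro u v hu hv huv
    have := hPS _ (hmemS _ _ huv)
    rwa [map_sub, hu, hv, sub_eq_zero] at this
  have hlift : ∀ i, ∃ u, S.mkQ u = q i := fun i => S.mkQ_surjective (q i)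
  choose lift hlift using hlift
  let bv : Fin n → (Fin n → ℝ) := fun i =>
    if hi : (i : ℕ) < m then P (lift ⟨i, hi⟩) else X i p₀
  have hbv1 : ∀ i : Fin m, bv (Fin.castLE hmn i) = P (lift i) := by
    intro i
    have : ((Fin.castLE hmn i : Fin n) : ℕ) < m := i.2
    simp only [bv, this, dif_pos]
    rfl
  have hbv2 : ∀ i : Fin n, m ≤ (i : ℕ) → bv i = X i p₀ := by
    intro i hi
    have : ¬ (i : ℕ) < m := by omega
    simp only [bv, this, dif_neg, not_false_eq_true]
  have hbvS : ∀ i : Fin n, m ≤ (i : ℕ) → bv i ∈ S := by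
    intro i hi
    rw [hbv2 i hi, hS]
    apply Submodule.subset_span
    refine ⟨⟨(i : ℕ) - m, by omega⟩, ?_⟩
    have : (⟨m + ((i : ℕ) - m), by omega⟩ : Fin n) = i := Fin.ext (by simp; omega)
    simp only [this]
  have hbvmk : ∀ y : Fin n → ℝ, S.mkQ (∑ j, y j • bv j) = ∑ j, y (Fin.castLE hmn j) • q j := by
    intro y
    rw [sum_split hmn, map_add, map_sum, map_sum]
    have h2 : ∑ k : Fin (n - m), S.mkQ (y ⟨m + (k : ℕ), by omega⟩ • bv ⟨m + (k : ℕ), by omega⟩)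
        = 0 := by
      refine Finset.sum_eq_zero fun k _ => ?_
      rw [map_smul]
      have : S.mkQ (bv ⟨m + (k : ℕ), by omega⟩) = 0 :=
        (Submodule.Quotient.mk_eq_zero S).2 (hbvS _ (by simp))
      rw [this, smul_zero]
    rw [h2, add_zero]
    refine Finset.sum_congr rfl fun j _ => ?_
    rw [map_smul, hbv1, hPmk, hlift]
  have hbind : LinearIndependent ℝ bv := by
    rw [Fintype.linearIndependent_iff]
    intro g hg
    have h1 := hbvmk g
    rw [hg, map_zero] at h1
    have h2 := Fintype.linearIndependent_iff.1 q.linearIndependent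
      (fun j => g (Fin.castLE hmn j)) h1.symm
    rw [sum_split hmn] at hg
    have h3 : ∑ i : Fin m, g (Fin.castLE hmn i) • bv (Fin.castLE hmn i) = 0 :=
      Finset.sum_eq_zero fun i _ => by rw [h2 i, zero_smul]
    rw [h3, zero_add] at hg
    have h4 := Fintype.linearIndependent_iff.1 hlin
      (fun k => g ⟨m + (k : ℕ), by omega⟩) (by
        rw [← hg]
        refine Finset.sum_congr rfl fun k _ => ?_
        rw [hbv2 _ (by simp)])
    intro i
    by_cases hi : (i : ℕ) < m
    · exact h2 ⟨i, hi⟩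
    · have := h4 ⟨(i : ℕ) - m, by omega⟩
      have hh : (⟨m + ((i : ℕ) - m), by omega⟩ : Fin n) = i := Fin.ext (by simp; omega)
      simp only [hh] at this
      exact this
  have : Nonempty (Fin n) := ⟨⟨0, by omega⟩⟩
  let b : Module.Basis (Fin n) ℝ (Fin n → ℝ) :=
    basisOfLinearIndependentOfCardEqFinrank hbind (by simp)
  have hb : ∀ i, b i = bv i := by
    intro i; simp [b]
  -- the matrix
  let v : Fin n → Fin n → ℝ := fun i => if hi : (i : ℕ) < m then η ⟨i, hi⟩ else Pi.single i 1
  have hv1 : ∀ i : Fin m, v (Fin.castLE hmn i) = η i := by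
    intro i
    have : ((Fin.castLE hmn i : Fin n) : ℕ) < m := i.2
    simp only [v, this, dif_pos]
    rfl
  have hv2 : ∀ i : Fin n, m ≤ (i : ℕ) → v i = Pi.single i 1 := by
    intro i hi
    have : ¬ (i : ℕ) < m := by omega
    simp only [v, this, dif_neg, not_false_eq_true]
  let R : Fin n → (Fin n → ℝ) → (Fin n → ℝ) := fun i => cmb (v i)
  have hR1 : ∀ i : Fin m, R (Fin.castLE hmn i) p₀ = 0 := by
    intro i
    simp only [R, hv1, η, map_sum, map_smul, hζ, Finset.sum_apply, Pi.smul_apply, hZfix, smul_zero,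
      Finset.sum_const_zero]
  have hR2 : ∀ i : Fin n, m ≤ (i : ℕ) → R i = X i := by
    intro i hi
    simp only [R, hv2 i hi, hX1]
  have hvind : LinearIndependent ℝ v := by
    rw [Fintype.linearIndependent_iff]
    intro g hg
    have h1 : ∑ i, g i • R i = 0 := by
      have := congrArg cmb hg
      rw [map_sum, map_zero] at this
      rw [← this]
      refine Finset.sum_congr rfl fun i _ => ?_
      rw [map_smul]
    have h2 := congrFun h1 p₀
    rw [Finset.sum_apply, sum_split hmn] at h2
    have h3 : ∑ i : Fin m, (g (Fin.castLE hmn i) • R (Fin.castLE hmn i)) p₀ = 0 :=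
      Finset.sum_eq_zero fun i _ => by rw [Pi.smul_apply, hR1 i, smul_zero]
    rw [h3, zero_add] at h2
    have h4 := Fintype.linearIndependent_iff.1 hlin
      (fun k => g ⟨m + (k : ℕ), by omega⟩) (by
        rw [Pi.zero_apply] at h2
        refine Eq.trans ?_ h2
        refine Finset.sum_congr rfl fun k _ => ?_
        rw [hR2 _ (by simp)]
        rfl)
    have h5 : ∑ i : Fin m, g (Fin.castLE hmn i) • η i = 0 := by
      rw [sum_split hmn] at hg
      have h6 : ∑ k : Fin (n - m), g ⟨m + (k : ℕ), by omega⟩ • v ⟨m + (k : ℕ), by omega⟩ = 0 :=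
        Finset.sum_eq_zero fun k _ => by rw [h4 k, zero_smul]
      rw [h6, add_zero] at hg
      simpa only [hv1] using hg
    have h7 := Fintype.linearIndependent_iff.1 hFind (fun i => g (Fin.castLE hmn i)) (by
      apply Submodule.linearMap_qext
      refine LinearMap.ext fun u => ?_
      change (∑ i : Fin m, g (Fin.castLE hmn i) • ∑ j, w i j • Abar j) (S.mkQ u) = 0
      rw [LinearMap.sum_apply]
      have h8 := congrArg (fun T => S.mkQ (D p₀ T u)) h5
      simp only [map_sum, map_smul, map_zero, ContinuousLinearMap.zero_apply,
        ContinuousLinearMap.sum_apply, ContinuousLinearMap.coe_smul', Pi.smul_apply] at h8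
      refine Eq.trans (Finset.sum_congr rfl fun i _ => ?_) h8
      rw [LinearMap.smul_apply, hFmk])
    intro i
    by_cases hi : (i : ℕ) < m
    · exact h7 ⟨i, hi⟩
    · have := h4 ⟨(i : ℕ) - m, by omega⟩
      have hh : (⟨m + ((i : ℕ) - m), by omega⟩ : Fin n) = i := Fin.ext (by simp; omega)
      simp only [hh] at this
      exact this
  -- global smooth fields
  have hcut : ∀ i, ∃ f' : (Fin n → ℝ) → (Fin n → ℝ), ContDiff ℝ (⊤ : ℕ∞) f' ∧
      Filter.EventuallyEq (nhds p₀) f' (R i) := fun i => cutoff (R i) U hUopen p₀ hp₀ (hcmbs (v i))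
  choose G hGs hGe using hcut
  let T : Fin n → (Fin n → ℝ) → (Fin n → ℝ) := fun i x => G i (p₀ + x)
  have hTs : ∀ i, ContDiff ℝ (⊤ : ℕ∞) (T i) := fun i =>
    (hGs i).comp (contDiff_const.add contDiff_id)
  have htr : Filter.Tendsto (fun x : Fin n → ℝ => p₀ + x) (nhds 0) (nhds p₀) := by
    have : Continuous (fun x : Fin n → ℝ => p₀ + x) := by fun_prop
    simpa using this.tendsto 0
  have hTv : ∀ i, ∀ᶠ x in nhds 0, T i x = R i (p₀ + x) := fun i => htr.eventually (hGe i)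
  have hTd : ∀ i, ∀ᶠ x in nhds 0, fderiv ℝ (T i) x = D (p₀ + x) (v i) := by
    intro i
    filter_upwards [htr.eventually ((hGe i).fderiv (𝕜 := ℝ)), htr.eventually hmemU] with x hx hxU
    rw [← (hcmbd (v i) (p₀ + x) hxU).fderiv]
    refine Eq.trans ?_ hx
    exact fderiv_comp_add_left p₀
  have hTcomm : ∀ i j, ∀ᶠ x in nhds 0, fderiv ℝ (T j) x (T i x) = fderiv ℝ (T i) x (T j x) := by
    intro i j
    filter_upwards [hTv i, hTv j, hTd i, hTd j, htr.eventually hmemU] with x h1 h2 h3 h4 h5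
    rw [h1, h2, h3, h4]
    exact hbr _ _ _ h5
  have hTd0 : ∀ i : Fin m, fderiv ℝ (T (Fin.castLE hmn i)) 0 = AY i := by
    intro i
    have h1 := (hTd (Fin.castLE hmn i)).self_of_nhds
    rw [hv1, add_zero] at h1
    exact h1
  have hPb : ∀ j : Fin n, P (b j) = if (j : ℕ) < m then b j else 0 := by
    intro j
    rw [hb]
    split_ifs with hj
    · have := hbv1 ⟨j, hj⟩
      change bv j = _ at this
      rw [this, hPP]
    · exact hPS _ (hbvS j (by omega))
  obtain ⟨ψ0, hψ0, hψs, hψd, hψR⟩ := main_loc (h := h) (e := e) hhe hmn T hTs hTcomm b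
    (by
      intro i
      have h1 := (hTv i).self_of_nhds
      rw [add_zero] at h1
      rw [h1]
      split_ifs with hi
      · exact hR1 ⟨i, hi⟩
      · rw [hR2 i (by omega), hb, hbv2 i (by omega)])
    (fun i => if hi : (i : ℕ) < m then a ⟨i, hi⟩ else 0)
    (by
      intro i hi
      have : ¬ (i : ℕ) < m := by omega
      simp only [this, dif_neg, not_false_eq_true])
    (by
      intro j
      rw [← hPb j, hPv, sum_split hmn]
      have h6 : ∑ k : Fin (n - m), (if hi : m + (k : ℕ) < m then a ⟨m + (k : ℕ), hi⟩ else 0) •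
          fderiv ℝ (T ⟨m + (k : ℕ), by omega⟩) 0 (b j) = 0 := by
        refine Finset.sum_eq_zero fun k _ => ?_
        have : ¬ m + (k : ℕ) < m := by omega
        simp only [this, dif_neg, not_false_eq_true, zero_smul]
      refine Eq.trans (congrArg₂ (· + ·) (Finset.sum_congr rfl fun i _ => ?_) h6) (add_zero _)
      have : ((Fin.castLE hmn i : Fin n) : ℕ) < m := i.2
      simp only [this, dif_pos, hTd0]
      rfl)
    (by
      intro i hi y
      have h1 : fderiv ℝ (T i) 0 = AY ⟨i, hi⟩ := hTd0 ⟨i, hi⟩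
      rw [h1]
      simp only [hb]
      apply hPeq
      · exact hPA _ _
      · rw [map_sum]
        refine Finset.sum_congr rfl fun j _ => ?_
        rw [map_smul, ← hb, hPb]
        split_ifs with hj
        · rfl
        · have := modelVF_ge n m h e hhe hmn ⟨i, hi⟩ y j (by omega)
          change modelVF n m h i y j = 0 at this
          rw [this]; simp
      · rw [← hFmk, hbvmk, hbvmk]
        exact hFmod ⟨i, hi⟩ y)
  let β : (Fin n → ℝ) ≃L[ℝ] (Fin n → ℝ) := b.equivFun.symm.toContinuousLinearEquiv
  have hβ : ∀ y, β y = ∑ j, y j • b j := fun y => b.equivFun_symm_apply y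
  have hβs : ∀ u, β.symm u = b.repr u := fun u => rfl
  obtain ⟨V, W, c1, c2, c3, c4, c5, φ, ψ, d1, d2, d3, d4, d5, d6, d7, d8, d9⟩ :=
    main_chart U hUopen p₀ hp₀ R (fun i => modelVF n m h i) β ψ0 hψ0 hψs hψd (by
      intro i
      have ht : Filter.Tendsto ψ0 (nhds 0) (nhds 0) := by
        have := hψd.continuousAt.tendsto
        rwa [hψ0] at this
      filter_upwards [hψR i, ht.eventually (hTv i)] with u h1 h2
      rw [hβ, hβs, h1, h2])
  refine ⟨h, e, hhe, V, W, c1, c2, c3, c4, c5, φ, ψ, d1, d2, d3, d4, d5, d6, d7, d8,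
    Matrix.of v, ?_, ?_⟩
  · exact Matrix.linearIndependent_rows_iff_isUnit.1 hvind
  · intro i x hx
    have := d9 i x hx
    rw [← this, ← hcmb]
    rfl
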